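/- In the moderately sparse regime, the higher criticism rank test achieves the detection boundary in the Gaussian mixture copula model: let F and G be strictly increasing continuous distribution functions on ℝ, and suppose the observations are (X_i, Y_i) = (F^{-1}(Φ(Z¹_i)), G^{-1}(Φ(Z²_i))) for i = 1,…,n, where (Z¹_i, Z²_i) are i.i.d. from P_{ε_n,ρ_n}. Let R_i, S_i be the ranks of X_i, Y_i in their respective samples, D_i := |R_i − S_i|, u(t) := (n(2t+1) − t(t+1))/n², and HC_rank := max_{0 ≤ t ≤ n/2} (Σ_{i=1}^n 1{D_i ≤ t} − n·u(t)) / √(n·u(t)(1 − u(t))). If ε_n = n^{-β} with β ∈ (1/2, 3/4) fixed and ρ_n = 1 − n^{-γ} with γ > 0 fixed such that γ > 4(β − 1/2), then the sequence of tests rejecting when HC_rank ≥ (log n)² is asymptotically powerful: its type I error probability (computed when X₁,…,Xₙ,Y₁,…,Yₙ are all mutually independent with continuous marginals) and its type II error probability both tend to 0. -/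

import Mathlib

open MeasureTheory ProbabilityTheory Real Filter Topology

noncomputable section

/-- The standard normal distribution on ℝ. -/
def stdGauss : Measure ℝ := gaussianReal 0 1

/-- Two independent standard normals. -/
def stdGauss2 : Measure (ℝ × ℝ) := stdGauss.prod stdGauss

/-- `N(0, Σ_ρ)`: the centered bivariate normal with unit marginal variances and
correlation `ρ`, i.e. the law of `(Z₁, ρ Z₁ + √(1-ρ²) Z₂)` for independent standard
normal `Z₁, Z₂`. -/
def biNormal (ρ : ℝ) : Measure (ℝ × ℝ) :=
  stdGauss2.map fun z => (z.1, ρ * z.1 + Real.sqrt (1 - ρ ^ 2) * z.2)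

/-- The contamination mixture `P_{ε,ρ} = (1-ε) N(0,Σ₀) + ε N(0,Σ_ρ)`. -/
def mixture (ε ρ : ℝ) : Measure (ℝ × ℝ) :=
  ENNReal.ofReal (1 - ε) • biNormal 0 + ENNReal.ofReal ε • biNormal ρ

/-- The `n`-fold product (i.i.d.) measure. -/
def iid (n : ℕ) (μ : Measure (ℝ × ℝ)) : Measure (Fin n → ℝ × ℝ) :=
  Measure.pi fun _ => μ
/-- The standard normal distribution function. -/
def Phi (t : ℝ) : ℝ := (stdGauss (Set.Iic t)).toReal

/-- The rank (in `{1, …, n}`) of the `i`-th entry of `x` among `x 1, …, x n`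
(assuming no ties). -/
def rankOf (n : ℕ) (x : Fin n → ℝ) (i : Fin n) : ℕ :=
  (Finset.univ.filter fun j => x j ≤ x i).card

/-- The observation map of the Gaussian mixture copula model: the latent vector
`z = ((Z¹₁,Z²₁),…,(Z¹ₙ,Z²ₙ))` is observed as `(Xᵢ, Yᵢ) = (F⁻¹(Φ(Z¹ᵢ)), G⁻¹(Φ(Z²ᵢ)))`. -/
def obsMap (F G : ℝ → ℝ) (n : ℕ) (z : Fin n → ℝ × ℝ) : Fin n → ℝ × ℝ :=
  fun i => (Function.invFun F (Phi (z i).1), Function.invFun G (Phi (z i).2))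

/-- The absolute rank difference `Dᵢ = |Rᵢ - Sᵢ|`. -/
def rankDiff (n : ℕ) (x : Fin n → ℝ × ℝ) (i : Fin n) : ℕ :=
  ((rankOf n (fun j => (x j).1) i : ℤ) - (rankOf n (fun j => (x j).2) i : ℤ)).natAbs

/-- The null distribution function `u(t) = (n(2t+1) - t(t+1))/n²` of `Dᵢ`. -/
def nullCdf (n t : ℕ) : ℝ :=
  ((n : ℝ) * (2 * t + 1) - t * (t + 1)) / (n : ℝ) ^ 2

/-- The higher criticism rank statistic
`HC_rank = max_{0 ≤ t ≤ n/2} (Σᵢ 1{Dᵢ ≤ t} - n u(t)) / √(n u(t)(1 - u(t)))`,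
the max being over integer thresholds `t`. -/
def HCrank (n : ℕ) (x : Fin n → ℝ × ℝ) : ℝ :=
  (Finset.range (n / 2 + 1)).sup' (by simp) fun t =>
    (((Finset.univ.filter fun i : Fin n => rankDiff n x i ≤ t).card : ℝ) - n * nullCdf n t)
      / Real.sqrt (n * nullCdf n t * (1 - nullCdf n t))

section Permutation

variable {ι : Type*} [Fintype ι] [DecidableEq ι]

/-- The permutation statistic `∑ᵢ a(i, σ i)`. -/
def permSum (a : ι → ι → ℝ) (σ : Equiv.Perm ι) : ℝ := ∑ i, a i (σ i)

/-- The mean of `permSum a` under a uniform random permutation. -/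
def permMean (a : ι → ι → ℝ) : ℝ := (∑ i, ∑ k, a i k) / Fintype.card ι

lemma permSum_sub_swap (a : ι → ι → ℝ) (σ : Equiv.Perm ι) (i j : ι) :
    permSum a σ - permSum a (σ * Equiv.swap i j)
      = a i (σ i) + a j (σ j) - a i (σ j) - a j (σ i) := by
  rcases eq_or_ne i j with rfl | hij
  · rw [Equiv.swap_self, ← Equiv.Perm.one_def, mul_one]
    ring
  · have hsub : ∑ k, (a k (σ k) - a k ((σ * Equiv.swap i j) k))
        = ∑ k ∈ {i, j}, (a k (σ k) - a k ((σ * Equiv.swap i j) k)) := by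
      symm
      apply Finset.sum_subset (Finset.subset_univ _)
      intro k _ hk
      simp only [Finset.mem_insert, Finset.mem_singleton, not_or] at hk
      simp [Equiv.swap_apply_of_ne_of_ne hk.1 hk.2]
    unfold permSum
    rw [← Finset.sum_sub_distrib, hsub, Finset.sum_pair hij]
    simp
    ring

lemma sum_permSum_sub_swap [Nonempty ι] (a : ι → ι → ℝ) (σ : Equiv.Perm ι) :
    ∑ i, ∑ j, (permSum a σ - permSum a (σ * Equiv.swap i j))
      = 2 * Fintype.card ι * (permSum a σ - permMean a) := by
  have hN : (Fintype.card ι : ℝ) ≠ 0 := by exact_mod_cast Fintype.card_ne_zero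
  have h1 : ∀ i, ∑ j, a i (σ j) = ∑ k, a i k := fun i => Equiv.sum_comp σ (a i)
  have h2 : ∑ i, ∑ j, a j (σ i) = ∑ i, ∑ k, a i k := by
    rw [Finset.sum_comm]; simp [h1]
  simp only [permSum_sub_swap, Finset.sum_sub_distrib, Finset.sum_add_distrib, h2, h1,
    Finset.sum_const, Finset.card_univ, nsmul_eq_mul]
  rw [← Finset.mul_sum]
  unfold permMean permSum
  field_simp
  ring

lemma sum_permSum_sub_permMean_mul [Nonempty ι] (a : ι → ι → ℝ) (f : Equiv.Perm ι → ℝ) :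
    4 * Fintype.card ι * ∑ σ, (permSum a σ - permMean a) * f σ
      = ∑ i, ∑ j, ∑ σ, (permSum a σ - permSum a (σ * Equiv.swap i j))
          * (f σ - f (σ * Equiv.swap i j)) := by
  have key : ∀ i j, ∑ σ, (permSum a σ - permSum a (σ * Equiv.swap i j))
          * (f σ - f (σ * Equiv.swap i j))
      = 2 * ∑ σ, (permSum a σ - permSum a (σ * Equiv.swap i j)) * f σ := by
    intro i j
    have h := Equiv.sum_comp (Equiv.mulRight (Equiv.swap i j))
      (fun σ => (permSum a σ - permSum a (σ * Equiv.swap i j)) * f σ)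
    simp only [Equiv.coe_mulRight, mul_assoc, Equiv.swap_mul_self, mul_one] at h
    rw [two_mul]
    nth_rewrite 2 [← h]
    rw [← Finset.sum_add_distrib]
    exact Finset.sum_congr rfl fun σ _ => by ring
  simp only [key]
  have h3 : ∑ i, ∑ j, ∑ σ, (permSum a σ - permSum a (σ * Equiv.swap i j)) * f σ
      = ∑ σ, 2 * Fintype.card ι * (permSum a σ - permMean a) * f σ := by
    rw [Finset.sum_congr rfl fun i _ => Finset.sum_comm, Finset.sum_comm]
    refine Finset.sum_congr rfl fun σ _ => ?_
    rw [← sum_permSum_sub_swap]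
    simp only [Finset.sum_mul]
  simp only [← Finset.mul_sum, h3, mul_assoc]
  ring

lemma sum_swap_sq_le (a : ι → ι → ℝ) (h0 : ∀ i k, 0 ≤ a i k) (h1 : ∀ i k, a i k ≤ 1)
    (σ : Equiv.Perm ι) [Nonempty ι] :
    ∑ i, ∑ j, (permSum a σ - permSum a (σ * Equiv.swap i j)) ^ 2
      ≤ 4 * Fintype.card ι * (permSum a σ + permMean a) := by
  have hN : (Fintype.card ι : ℝ) ≠ 0 := by exact_mod_cast Fintype.card_ne_zero
  have hle : ∑ i, ∑ j, (permSum a σ - permSum a (σ * Equiv.swap i j)) ^ 2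
      ≤ ∑ i, ∑ j, 2 * (a i (σ i) + a j (σ j) + a i (σ j) + a j (σ i)) := by
    refine Finset.sum_le_sum fun i _ => Finset.sum_le_sum fun j _ => ?_
    rw [permSum_sub_swap]
    have := h0 i (σ i); have := h0 j (σ j); have := h0 i (σ j); have := h0 j (σ i)
    have := h1 i (σ i); have := h1 j (σ j); have := h1 i (σ j); have := h1 j (σ i)
    rw [← sq_abs]
    have hA : |a i (σ i) + a j (σ j) - a i (σ j) - a j (σ i)| ≤ 2 := by
      rw [abs_le]; constructor <;> linarith
    have hB : |a i (σ i) + a j (σ j) - a i (σ j) - a j (σ i)|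
        ≤ a i (σ i) + a j (σ j) + a i (σ j) + a j (σ i) := by
      rw [abs_le]; constructor <;> linarith
    nlinarith [abs_nonneg (a i (σ i) + a j (σ j) - a i (σ j) - a j (σ i))]
  refine hle.trans (le_of_eq ?_)
  have h1 : ∀ i, ∑ j, a i (σ j) = ∑ k, a i k := fun i => Equiv.sum_comp σ (a i)
  have h2 : ∑ i, ∑ j, a j (σ i) = ∑ i, ∑ k, a i k := by
    rw [Finset.sum_comm]; simp [h1]
  simp only [← Finset.mul_sum, Finset.sum_add_distrib, h2, h1,
    Finset.sum_const, Finset.card_univ, nsmul_eq_mul]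
  unfold permMean permSum
  field_simp
  ring

lemma sum_permSum [Nonempty ι] (a : ι → ι → ℝ) :
    ∑ σ, permSum a σ = Fintype.card (Equiv.Perm ι) * permMean a := by
  have hN : (Fintype.card ι : ℝ) ≠ 0 := by exact_mod_cast Fintype.card_ne_zero
  have h := sum_permSum_sub_permMean_mul a (fun _ => 1)
  simp only [sub_self, mul_zero, Finset.sum_const_zero, mul_one, mul_eq_zero,
    Finset.sum_sub_distrib, Finset.sum_const, Finset.card_univ, nsmul_eq_mul] at h
  rcases h with h | h
  · simp [hN] at h
  · linarith

lemma sum_sq_permSum_sub_permMean_le [Nonempty ι] (a : ι → ι → ℝ) (h0 : ∀ i k, 0 ≤ a i k)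
    (h1 : ∀ i k, a i k ≤ 1) :
    ∑ σ, (permSum a σ - permMean a) ^ 2
      ≤ Fintype.card (Equiv.Perm ι) * (2 * permMean a) := by
  have hN : (0 : ℝ) < Fintype.card ι := by exact_mod_cast Fintype.card_pos
  have h := sum_permSum_sub_permMean_mul a (permSum a)
  have hL : ∑ σ, (permSum a σ - permMean a) * permSum a σ
      = ∑ σ, (permSum a σ - permMean a) ^ 2 := by
    have : ∑ σ, (permSum a σ - permMean a) * permMean a = 0 := by
      rw [← Finset.sum_mul, Finset.sum_sub_distrib, sum_permSum]
      simp
    rw [← sub_zero (∑ σ, (permSum a σ - permMean a) * permSum a σ), ← this,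
      ← Finset.sum_sub_distrib]
    exact Finset.sum_congr rfl fun σ _ => by ring
  have hR : ∑ i, ∑ j, ∑ σ, (permSum a σ - permSum a (σ * Equiv.swap i j))
          * (permSum a σ - permSum a (σ * Equiv.swap i j))
      ≤ ∑ σ, 4 * Fintype.card ι * (permSum a σ + permMean a) := by
    rw [Finset.sum_congr rfl fun i _ => Finset.sum_comm, Finset.sum_comm]
    refine Finset.sum_le_sum fun σ _ => ?_
    simpa only [sq] using sum_swap_sq_le a h0 h1 σ
  rw [hL] at h
  rw [← h, ← Finset.mul_sum, Finset.sum_add_distrib, sum_permSum] at hR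
  have := le_of_mul_le_mul_left hR (by positivity)
  simp at this
  linarith

/-- Chebyshev's inequality for the lower tail of `permSum`. -/
lemma card_permSum_le [Nonempty ι] (a : ι → ι → ℝ) (h0 : ∀ i k, 0 ≤ a i k)
    (h1 : ∀ i k, a i k ≤ 1) {s : ℝ} (hs : 0 < s) :
    ((Finset.univ.filter fun σ => permSum a σ ≤ permMean a - s).card : ℝ)
      ≤ Fintype.card (Equiv.Perm ι) * (2 * permMean a / s ^ 2) := by
  have h := sum_sq_permSum_sub_permMean_le a h0 h1
  have : ((Finset.univ.filter fun σ => permSum a σ ≤ permMean a - s).card : ℝ) * s ^ 2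
      ≤ ∑ σ, (permSum a σ - permMean a) ^ 2 := by
    rw [← nsmul_eq_mul]
    refine (Finset.card_nsmul_le_sum _ (fun σ => (permSum a σ - permMean a) ^ 2) _ ?_).trans
      (Finset.sum_le_sum_of_subset_of_nonneg (Finset.filter_subset _ _) fun _ _ _ => sq_nonneg _)
    intro σ hσ
    have := (Finset.mem_filter.mp hσ).2
    nlinarith
  rw [← mul_div_assoc, le_div_iff₀ (by positivity)]
  exact this.trans h

lemma sub_mul_exp_sub_exp_le (x y : ℝ) :
    (x - y) * (rexp x - rexp y) ≤ (x - y) ^ 2 * (rexp x + rexp y) := by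
  have key : ∀ u v : ℝ, v ≤ u → rexp u - rexp v ≤ (u - v) * (rexp u + rexp v) := by
    intro u v huv
    have h := Real.add_one_le_exp (v - u)
    have h2 : rexp v = rexp (v - u) * rexp u := by rw [← Real.exp_add]; ring_nf
    have := mul_le_mul_of_nonneg_right h (Real.exp_pos u).le
    nlinarith [mul_nonneg (sub_nonneg.mpr huv) (Real.exp_pos v).le]
  rcases le_total x y with h | h
  · nlinarith [key y x h]
  · nlinarith [key x y h]

lemma sum_permSum_sub_permMean_mul_exp_le [Nonempty ι] (a : ι → ι → ℝ)
    (h0 : ∀ i k, 0 ≤ a i k) (h1 : ∀ i k, a i k ≤ 1) {θ : ℝ} (hθ : 0 < θ) :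
    ∑ σ, (permSum a σ - permMean a) * rexp (θ * permSum a σ)
      ≤ 2 * θ * ∑ σ, (permSum a σ + permMean a) * rexp (θ * permSum a σ) := by
  have hN : (0 : ℝ) < Fintype.card ι := by exact_mod_cast Fintype.card_pos
  have h := sum_permSum_sub_permMean_mul a (fun σ => rexp (θ * permSum a σ))
  have hR : ∀ i j, ∑ σ, (permSum a σ - permSum a (σ * Equiv.swap i j))
          * (rexp (θ * permSum a σ) - rexp (θ * permSum a (σ * Equiv.swap i j)))
      ≤ 2 * θ * ∑ σ, (permSum a σ - permSum a (σ * Equiv.swap i j)) ^ 2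
          * rexp (θ * permSum a σ) := by
    intro i j
    have hsw := Equiv.sum_comp (Equiv.mulRight (Equiv.swap i j))
      (fun σ => (permSum a σ - permSum a (σ * Equiv.swap i j)) ^ 2 * rexp (θ * permSum a σ))
    simp only [Equiv.coe_mulRight, mul_assoc, Equiv.swap_mul_self, mul_one] at hsw
    have : 2 * ∑ σ, (permSum a σ - permSum a (σ * Equiv.swap i j)) ^ 2
          * rexp (θ * permSum a σ)
        = ∑ σ, (permSum a σ - permSum a (σ * Equiv.swap i j)) ^ 2
          * (rexp (θ * permSum a σ) + rexp (θ * permSum a (σ * Equiv.swap i j))) := by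
      rw [two_mul]
      nth_rewrite 2 [← hsw]
      rw [← Finset.sum_add_distrib]
      exact Finset.sum_congr rfl fun σ _ => by ring
    rw [mul_comm 2 θ, mul_assoc, this, Finset.mul_sum]
    refine Finset.sum_le_sum fun σ _ => ?_
    have := sub_mul_exp_sub_exp_le (θ * permSum a σ) (θ * permSum a (σ * Equiv.swap i j))
    refine le_of_mul_le_mul_left ?_ hθ
    nlinarith
  have hS : ∑ i, ∑ j, ∑ σ, (permSum a σ - permSum a (σ * Equiv.swap i j)) ^ 2
          * rexp (θ * permSum a σ)
      ≤ ∑ σ, 4 * Fintype.card ι * ((permSum a σ + permMean a) * rexp (θ * permSum a σ)) := by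
    rw [Finset.sum_congr rfl fun i _ => Finset.sum_comm, Finset.sum_comm]
    refine Finset.sum_le_sum fun σ _ => ?_
    simp only [← Finset.sum_mul]
    rw [← mul_assoc]
    exact mul_le_mul_of_nonneg_right (sum_swap_sq_le a h0 h1 σ) (Real.exp_pos _).le
  rw [← Finset.mul_sum] at hS
  have hT := Finset.sum_le_sum fun i (_ : i ∈ Finset.univ) =>
    Finset.sum_le_sum fun j (_ : j ∈ Finset.univ) => hR i j
  rw [← h] at hT
  simp only [← Finset.mul_sum] at hT
  have hU := hT.trans (mul_le_mul_of_nonneg_left hS (by positivity : 0 ≤ 2 * θ))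
  refine le_of_mul_le_mul_left ?_ (by positivity : (0 : ℝ) < 4 * Fintype.card ι)
  linarith

lemma sum_exp_permSum_le [Nonempty ι] (a : ι → ι → ℝ)
    (h0 : ∀ i k, 0 ≤ a i k) (h1 : ∀ i k, a i k ≤ 1) {θ : ℝ} (hθ : 0 ≤ θ) (hθ' : θ ≤ 1 / 6) :
    ∑ σ, rexp (θ * permSum a σ)
      ≤ Fintype.card (Equiv.Perm ι) * rexp (permMean a * (θ + 3 * θ ^ 2)) := by
  set μ := permMean a with hμ
  have hμ0 : 0 ≤ μ := div_nonneg (Finset.sum_nonneg fun i _ => Finset.sum_nonneg fun k _ => h0 i k)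
    (Nat.cast_nonneg _)
  let m : ℝ → ℝ := fun θ => ∑ σ, rexp (θ * permSum a σ)
  let m' : ℝ → ℝ := fun θ => ∑ σ, rexp (θ * permSum a σ) * permSum a σ
  have hm : ∀ θ, HasDerivAt m (m' θ) θ := by
    intro θ
    refine HasDerivAt.fun_sum fun σ _ => ?_
    simpa using ((hasDerivAt_id θ).mul_const (permSum a σ)).exp
  let g : ℝ → ℝ := fun θ => m θ * rexp (-(μ * (θ + 3 * θ ^ 2)))
  have hg : ∀ θ, HasDerivAt g (m' θ * rexp (-(μ * (θ + 3 * θ ^ 2)))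
      + m θ * (rexp (-(μ * (θ + 3 * θ ^ 2))) * -(μ * (1 + 3 * (2 * θ))))) θ := by
    intro θ
    refine (hm θ).mul (HasDerivAt.exp ?_)
    refine HasDerivAt.neg (HasDerivAt.const_mul μ ?_)
    have := ((hasDerivAt_id θ).pow 2).const_mul 3
    convert! (hasDerivAt_id θ).add this using 1
    simp
  have hanti : AntitoneOn g (Set.Icc 0 (1 / 6)) := by
    refine antitoneOn_of_deriv_nonpos (convex_Icc _ _)
      (fun θ _ => (hg θ).continuousAt.continuousWithinAt)
      (fun θ _ => (hg θ).differentiableAt.differentiableWithinAt) ?_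
    intro θ hθ
    rw [interior_Icc] at hθ
    rw [(hg θ).deriv]
    have hk := sum_permSum_sub_permMean_mul_exp_le a h0 h1 hθ.1
    have e1 : ∑ σ, (permSum a σ - permMean a) * rexp (θ * permSum a σ) = m' θ - μ * m θ := by
      simp only [m, m', Finset.mul_sum, ← Finset.sum_sub_distrib]
      exact Finset.sum_congr rfl fun σ _ => by ring
    have e2 : ∑ σ, (permSum a σ + permMean a) * rexp (θ * permSum a σ) = m' θ + μ * m θ := by
      simp only [m, m', Finset.mul_sum, ← Finset.sum_add_distrib]
      exact Finset.sum_congr rfl fun σ _ => by ring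
    rw [e1, e2] at hk
    have hmp : 0 ≤ m θ := Finset.sum_nonneg fun σ _ => (Real.exp_pos _).le
    have hμm : 0 ≤ μ * m θ := mul_nonneg hμ0 hmp
    have hder : m' θ ≤ μ * m θ * (1 + 3 * (2 * θ)) := by
      have h2 := hθ.1
      have h3 := hθ.2
      have h4 : (1 - 2 * θ) * m' θ ≤ (1 + 2 * θ) * (μ * m θ) := by linarith
      have h5 : (1 + 2 * θ) * (μ * m θ) ≤ (1 - 2 * θ) * (μ * m θ * (1 + 3 * (2 * θ))) := by
        nlinarith [mul_nonneg hμm (mul_nonneg h2.le (by linarith : 0 ≤ 1 - 6 * θ))]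
      exact le_of_mul_le_mul_left (h4.trans h5) (by linarith)
    have hexp := Real.exp_pos (-(μ * (θ + 3 * θ ^ 2)))
    nlinarith
  have := hanti (Set.mem_Icc.mpr ⟨le_rfl, by norm_num⟩) (Set.mem_Icc.mpr ⟨hθ, hθ'⟩) hθ
  simp only [g, m, zero_mul, Real.exp_zero, Finset.sum_const, Finset.card_univ, nsmul_eq_mul,
    mul_one] at this
  rw [Real.exp_neg, ← div_eq_mul_inv, div_le_iff₀ (Real.exp_pos _)] at this
  simpa using this

/-- A Chernoff bound for the upper tail of `permSum`. -/
lemma card_le_permSum [Nonempty ι] (a : ι → ι → ℝ) (h0 : ∀ i k, 0 ≤ a i k)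
    (h1 : ∀ i k, a i k ≤ 1) (s : ℝ) {θ : ℝ} (hθ : 0 ≤ θ) (hθ' : θ ≤ 1 / 6) :
    ((Finset.univ.filter fun σ => permMean a + s ≤ permSum a σ).card : ℝ)
      ≤ Fintype.card (Equiv.Perm ι) * rexp (3 * θ ^ 2 * permMean a - θ * s) := by
  have h := sum_exp_permSum_le a h0 h1 hθ hθ'
  have : ((Finset.univ.filter fun σ => permMean a + s ≤ permSum a σ).card : ℝ)
        * rexp (θ * (permMean a + s))
      ≤ ∑ σ, rexp (θ * permSum a σ) := by
    rw [← nsmul_eq_mul]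
    refine (Finset.card_nsmul_le_sum _ (fun σ => rexp (θ * permSum a σ)) _ ?_).trans
      (Finset.sum_le_sum_of_subset_of_nonneg (Finset.filter_subset _ _)
        fun _ _ _ => (Real.exp_pos _).le)
    intro σ hσ
    have := (Finset.mem_filter.mp hσ).2
    exact Real.exp_le_exp.mpr (mul_le_mul_of_nonneg_left this hθ)
  rw [← le_div_iff₀ (Real.exp_pos _)] at this
  refine this.trans ?_
  rw [div_le_iff₀ (Real.exp_pos _), mul_assoc, ← Real.exp_add]
  rwa [show 3 * θ ^ 2 * permMean a - θ * s + θ * (permMean a + s)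
    = permMean a * (θ + 3 * θ ^ 2) by ring]

end Permutation

section Ranks

variable {n : ℕ}

lemma rankOf_comp (y : Fin n → ℝ) (σ : Equiv.Perm (Fin n)) (i : Fin n) :
    rankOf n (fun j => y (σ j)) i = rankOf n y (σ i) := by
  unfold rankOf
  refine Finset.card_bij (fun j _ => σ j) (by simp) (fun _ _ _ _ h => σ.injective h) ?_
  intro b hb
  exact ⟨σ.symm b, by simpa using hb, by simp⟩

lemma rankOf_comp_strictMono {f : ℝ → ℝ} (hf : StrictMono f) (y : Fin n → ℝ) (i : Fin n) :
    rankOf n (fun j => f (y j)) i = rankOf n y i := by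
  simp [rankOf, hf.le_iff_le]

lemma rankOf_lt_rankOf {y : Fin n → ℝ} {i j : Fin n} (h : y i < y j) :
    rankOf n y i < rankOf n y j := by
  refine Finset.card_lt_card (Finset.ssubset_iff_of_subset ?_ |>.mpr ⟨j, by simp, by simpa⟩)
  intro k hk
  simp only [Finset.mem_filter, Finset.mem_univ, true_and] at hk ⊢
  exact hk.trans h.le

lemma rankOf_injective {y : Fin n → ℝ} (hy : Function.Injective y) :
    Function.Injective (rankOf n y) := by
  intro i j h
  by_contra hij
  rcases lt_or_gt_of_ne (fun e => hij (hy e)) with h' | h'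
  · exact (rankOf_lt_rankOf h').ne h
  · exact (rankOf_lt_rankOf h').ne' h

lemma exists_equiv_rankOf {y : Fin n → ℝ} (hy : Function.Injective y) :
    ∃ r : Equiv.Perm (Fin n), ∀ i, rankOf n y i = (r i : ℕ) + 1 := by
  have hpos : ∀ i, 0 < rankOf n y i := fun i => Finset.card_pos.mpr ⟨i, by simp⟩
  have hle : ∀ i, rankOf n y i ≤ n := fun i => (Finset.card_le_univ _).trans (by simp)
  let f : Fin n → Fin n := fun i => ⟨rankOf n y i - 1, by have := hpos i; have := hle i; omega⟩
  have hf : ∀ i, rankOf n y i = (f i : ℕ) + 1 := fun i => by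
    have := hpos i; simp only [f]; omega
  have hinj : Function.Injective f := fun i j h =>
    rankOf_injective hy (by rw [hf, hf, h])
  exact ⟨Equiv.ofBijective f (Finite.injective_iff_bijective.mp hinj), hf⟩

/-- The indicator that the rank of `x i` and the rank of `y k` differ by at most `t`. -/
def closeRank (t : ℕ) (x y : Fin n → ℝ) (i k : Fin n) : ℝ :=
  if ((rankOf n x i : ℤ) - (rankOf n y k : ℤ)).natAbs ≤ t then 1 else 0

lemma closeRank_nonneg (t : ℕ) (x y : Fin n → ℝ) (i k : Fin n) : 0 ≤ closeRank t x y i k := by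
  unfold closeRank; split_ifs <;> norm_num

lemma closeRank_le_one (t : ℕ) (x y : Fin n → ℝ) (i k : Fin n) : closeRank t x y i k ≤ 1 := by
  unfold closeRank; split_ifs <;> norm_num

lemma closeRank_comm (t : ℕ) (x y : Fin n → ℝ) (i k : Fin n) :
    closeRank t x y i k = closeRank t y x k i := by
  unfold closeRank; rw [← Int.natAbs_neg, neg_sub]

lemma sum_closeRank_le (t : ℕ) (x : Fin n → ℝ) {y : Fin n → ℝ} (hy : Function.Injective y)
    (i : Fin n) : ∑ k, closeRank t x y i k ≤ 2 * t + 1 := by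
  unfold closeRank
  rw [Finset.sum_boole]
  have : (Finset.univ.filter fun k =>
      ((rankOf n x i : ℤ) - (rankOf n y k : ℤ)).natAbs ≤ t).card
      ≤ (Finset.Icc ((rankOf n x i : ℤ) - t) (rankOf n x i + t)).card := by
    refine Finset.card_le_card_of_injOn (fun k => (rankOf n y k : ℤ)) ?_ ?_
    · intro k hk
      simp only [Finset.coe_filter, Finset.mem_univ, true_and, Set.mem_ofPred_eq] at hk
      simp only [Finset.coe_Icc, Set.mem_Icc]
      omega
    · exact fun k _ l _ h => rankOf_injective hy (Int.ofNat_inj.mp h)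
  rw [Int.card_Icc] at this
  have h2 : ((rankOf n x i : ℤ) + t + 1 - ((rankOf n x i : ℤ) - t)).toNat = 2 * t + 1 := by omega
  rw [h2] at this
  exact_mod_cast this

lemma sum_range_natAbs_sub_le (n t : ℕ) (h : t ≤ n) :
    ∑ i ∈ Finset.range n, ∑ k ∈ Finset.range n,
      (if ((i : ℤ) - (k : ℤ)).natAbs ≤ t then (1 : ℝ) else 0) = n * (2 * t + 1) - t * (t + 1) := by
  induction n, h using Nat.le_induction with
  | base =>
    have : ∀ i ∈ Finset.range t, ∀ k ∈ Finset.range t,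
        (if ((i : ℤ) - (k : ℤ)).natAbs ≤ t then (1 : ℝ) else 0) = 1 := by
      intro i hi k hk
      simp only [Finset.mem_range] at hi hk
      rw [if_pos (by omega)]
    rw [Finset.sum_congr rfl fun i hi => Finset.sum_congr rfl (this i hi)]
    simp
    ring
  | succ m hm ih =>
    have hcol : ∑ k ∈ Finset.range m, (if ((m : ℤ) - (k : ℤ)).natAbs ≤ t then (1 : ℝ) else 0)
        = t := by
      rw [Finset.sum_boole]
      have : (Finset.range m).filter (fun k : ℕ => ((m : ℤ) - (k : ℤ)).natAbs ≤ t)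
          = Finset.Ico (m - t) m := by
        ext k; simp only [Finset.mem_filter, Finset.mem_range, Finset.mem_Ico]; omega
      rw [this, Nat.card_Ico, Nat.sub_sub_self hm]
    have hrow : ∑ k ∈ Finset.range m, (if ((k : ℤ) - (m : ℤ)).natAbs ≤ t then (1 : ℝ) else 0)
        = t := by
      rw [← hcol]
      refine Finset.sum_congr rfl fun k _ => ?_
      rw [← Int.natAbs_neg, neg_sub]
    rw [Finset.sum_range_succ, Finset.sum_range_succ]
    simp only [Finset.sum_range_succ _ m, Finset.sum_add_distrib]
    rw [ih, hcol, hrow]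
    simp
    ring

lemma sum_sum_closeRank {t : ℕ} (ht : t ≤ n) {x y : Fin n → ℝ} (hx : Function.Injective x)
    (hy : Function.Injective y) :
    ∑ i, ∑ k, closeRank t x y i k = n * (2 * t + 1) - t * (t + 1) := by
  obtain ⟨r, hr⟩ := exists_equiv_rankOf hx
  obtain ⟨s, hs⟩ := exists_equiv_rankOf hy
  rw [← sum_range_natAbs_sub_le n t ht]
  simp only [closeRank, hr, hs, Nat.cast_add, Nat.cast_one, add_sub_add_right_eq_sub]
  rw [Equiv.sum_comp r (fun i => ∑ k, if ((i : ℕ) - ((s k : Fin n) : ℕ) : ℤ).natAbs ≤ t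
    then (1 : ℝ) else 0)]
  rw [Finset.sum_range]
  refine Finset.sum_congr rfl fun i _ => ?_
  rw [Equiv.sum_comp s (fun k => if ((i : ℕ) - ((k : Fin n) : ℕ) : ℤ).natAbs ≤ t
    then (1 : ℝ) else 0), Finset.sum_range]

lemma sum_sum_closeRank_eq_nullCdf {t : ℕ} (hn : n ≠ 0) (ht : t ≤ n) {x y : Fin n → ℝ}
    (hx : Function.Injective x) (hy : Function.Injective y) :
    ∑ i, ∑ k, closeRank t x y i k = n * (n * nullCdf n t) := by
  have : (n : ℝ) ≠ 0 := by exact_mod_cast hn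
  rw [sum_sum_closeRank ht hx hy, nullCdf]
  field_simp

lemma sum_subtype_eq_false (c : Fin n → Bool) (f : Fin n → ℝ) :
    ∑ i : {i // c i = false}, f i = ∑ i with ¬ c i = true, f i :=
  (Finset.sum_subtype _ (by simp) f).symm

lemma sum_sum_subtype_closeRank_ge {t : ℕ} (hn : n ≠ 0) (ht : t ≤ n) {x y : Fin n → ℝ}
    (hx : Function.Injective x) (hy : Function.Injective y) (c : Fin n → Bool) :
    n * (n * nullCdf n t) - 2 * (Finset.univ.filter fun i => c i = true).card * (2 * t + 1)
      ≤ ∑ i : {i // c i = false}, ∑ k : {i // c i = false}, closeRank t x y i k := by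
  set C : Finset (Fin n) := Finset.univ.filter fun i => c i = true with hC
  have hsub : ∀ f : Fin n → ℝ, ∑ i : {i // c i = false}, f i = ∑ i, f i - ∑ i ∈ C, f i := by
    intro f
    have hs := Finset.sum_filter_add_sum_filter_not Finset.univ (fun i => c i = true) f
    rw [← hs, add_sub_cancel_left, sum_subtype_eq_false]
  have hrow : ∑ i ∈ C, ∑ k, closeRank t x y i k ≤ C.card * (2 * t + 1) := by
    rw [← nsmul_eq_mul]
    exact Finset.sum_le_card_nsmul _ _ _ fun i _ => sum_closeRank_le t x hy i
  have hcol : ∑ k ∈ C, ∑ i, closeRank t x y i k ≤ C.card * (2 * t + 1) := by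
    rw [← nsmul_eq_mul]
    refine Finset.sum_le_card_nsmul _ _ _ fun k _ => ?_
    simp only [closeRank_comm t x y _ k]
    exact sum_closeRank_le t y hx k
  have hnn : 0 ≤ ∑ i ∈ C, ∑ k ∈ C, closeRank t x y i k :=
    Finset.sum_nonneg fun i _ => Finset.sum_nonneg fun k _ => closeRank_nonneg t x y i k
  rw [hsub fun i => ∑ k : {i // c i = false}, closeRank t x y i k]
  simp only [fun i => hsub (closeRank t x y i), Finset.sum_sub_distrib]
  rw [Finset.sum_comm (s := Finset.univ) (t := C), sum_sum_closeRank_eq_nullCdf hn ht hx hy]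
  linarith

lemma mul_nullCdf_bounds {t : ℕ} (hn : 4 ≤ n) (ht : t ≤ n / 2) :
    1 ≤ n * nullCdf n t ∧ n * nullCdf n t ≤ 2 * t + 1 ∧ 1 / 16 ≤ 1 - nullCdf n t := by
  have hn' : (4 : ℝ) ≤ n := by exact_mod_cast hn
  have hn0 : (0 : ℝ) < n := by linarith
  have ht' : 2 * (t : ℝ) ≤ n := by
    have : 2 * t ≤ n := by omega
    exact_mod_cast this
  have ht0 : (0 : ℝ) ≤ t := Nat.cast_nonneg _
  have e : n * nullCdf n t = (n * (2 * t + 1) - t * (t + 1)) / n := by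
    unfold nullCdf; field_simp
  refine ⟨?_, ?_, ?_⟩
  · rw [e, le_div_iff₀ hn0]; nlinarith
  · rw [e, div_le_iff₀ hn0]; nlinarith
  · rw [le_sub_comm, nullCdf, div_le_iff₀ (by positivity)]; nlinarith

lemma sqrt_nullVar_pos {t : ℕ} (hn : 4 ≤ n) (ht : t ≤ n / 2) :
    0 < √(n * nullCdf n t * (1 - nullCdf n t)) := by
  obtain ⟨h1, -, h3⟩ := mul_nullCdf_bounds hn ht
  exact Real.sqrt_pos.mpr (mul_pos (by linarith) (by linarith))

lemma le_HCrank_iff (hn : 4 ≤ n) (L : ℝ) (x : Fin n → ℝ × ℝ) :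
    L ≤ HCrank n x ↔ ∃ t ≤ n / 2, n * nullCdf n t + L * √(n * nullCdf n t * (1 - nullCdf n t))
      ≤ ∑ i, closeRank t (fun j => (x j).1) (fun j => (x j).2) i i := by
  unfold HCrank
  rw [Finset.le_sup'_iff]
  simp only [Finset.mem_range, Nat.lt_add_one_iff]
  refine exists_congr fun t => and_congr_right fun ht => ?_
  change L ≤ _ / √(n * nullCdf n t * (1 - nullCdf n t)) ↔ _
  rw [le_div_iff₀ (sqrt_nullVar_pos hn ht), le_sub_iff_add_le']
  simp only [closeRank, Finset.sum_boole, rankDiff]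
  congr!

end Ranks

section Measures

variable {n : ℕ}

lemma measureReal_le_of_card_le {Ω κ : Type*} [MeasurableSpace Ω] {P : Measure Ω}
    [IsProbabilityMeasure P] [Fintype κ] [Nonempty κ] {T : κ → Ω → Ω}
    (hT : ∀ k, MeasurePreserving (T k) P P) {E : Set Ω} [DecidablePred (· ∈ E)]
    (hE : MeasurableSet E) {δ : ℝ}
    (h : ∀ᵐ ω ∂P, ((Finset.univ.filter fun k => T k ω ∈ E).card : ℝ) ≤ Fintype.card κ * δ) :
    P.real E ≤ δ := by
  have hN : (0 : ℝ) < Fintype.card κ := by exact_mod_cast Fintype.card_pos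
  have hm : ∀ k, MeasurableSet (T k ⁻¹' E) := fun k => (hT k).measurable hE
  have hint : ∀ k, Integrable ((T k ⁻¹' E).indicator (1 : Ω → ℝ)) P := fun k =>
    (integrable_const (1 : ℝ)).indicator (hm k)
  have h1 : Fintype.card κ * P.real E = ∫ ω, ∑ k, (T k ⁻¹' E).indicator (1 : Ω → ℝ) ω ∂P := by
    rw [integral_finsetSum _ fun k _ => hint k]
    simp only [fun k => integral_indicator_one (μ := P) (hm k),
      fun k => (hT k).measureReal_preimage hE.nullMeasurableSet]
    simp
  have h2 : ∀ ω, ∑ k, (T k ⁻¹' E).indicator (1 : Ω → ℝ) ω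
      = ((Finset.univ.filter fun k => T k ω ∈ E).card : ℝ) := by
    intro ω
    rw [Finset.card_filter, Nat.cast_sum]
    refine Finset.sum_congr rfl fun k _ => ?_
    by_cases hk : T k ω ∈ E
    · rw [Set.indicator_of_mem (by exact hk), if_pos hk]; simp
    · rw [Set.indicator_of_notMem (by exact hk), if_neg hk]; simp
  simp only [h2] at h1
  refine le_of_mul_le_mul_left ?_ hN
  rw [h1]
  calc _ ≤ ∫ _, Fintype.card κ * δ ∂P := by
        refine integral_mono_ae ?_ (integrable_const _) h
        simp only [← h2]
        exact integrable_finsetSum _ fun k _ => hint k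
    _ = _ := by simp

lemma measurable_rankOf (i : Fin n) : Measurable fun x : Fin n → ℝ => rankOf n x i := by
  simp only [rankOf, Finset.card_filter]
  exact Finset.measurable_sum _ fun j _ => Measurable.ite
    (measurableSet_le (measurable_pi_apply j) (measurable_pi_apply i))
    measurable_const measurable_const

lemma measurable_closeRank (t : ℕ) (i k : Fin n) :
    Measurable fun x : (Fin n → ℝ) × (Fin n → ℝ) => closeRank t x.1 x.2 i k := by
  unfold closeRank
  have hr : Measurable fun x : (Fin n → ℝ) × (Fin n → ℝ) => (rankOf n x.1 i, rankOf n x.2 k) :=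
    ((measurable_rankOf i).comp measurable_fst).prodMk ((measurable_rankOf k).comp measurable_snd)
  exact (measurable_of_countable
    (f := fun p : ℕ × ℕ => if ((p.1 : ℤ) - (p.2 : ℤ)).natAbs ≤ t then (1 : ℝ) else 0)).comp hr

lemma measurable_closeRank_pair (t : ℕ) (i : Fin n) :
    Measurable fun x : Fin n → ℝ × ℝ =>
      closeRank t (fun j => (x j).1) (fun j => (x j).2) i i :=
  (measurable_closeRank t i i).comp (f := fun x : Fin n → ℝ × ℝ =>
    ((fun j => (x j).1), (fun j => (x j).2))) (by fun_prop)

lemma measurableSet_le_HCrank (hn : 4 ≤ n) (L : ℝ) :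
    MeasurableSet {x : Fin n → ℝ × ℝ | L ≤ HCrank n x} := by
  simp only [le_HCrank_iff hn]
  have : {x : Fin n → ℝ × ℝ | ∃ t ≤ n / 2, n * nullCdf n t
        + L * √(n * nullCdf n t * (1 - nullCdf n t))
        ≤ ∑ i, closeRank t (fun j => (x j).1) (fun j => (x j).2) i i}
      = ⋃ t ∈ {t | t ≤ n / 2}, {x : Fin n → ℝ × ℝ | n * nullCdf n t
        + L * √(n * nullCdf n t * (1 - nullCdf n t))
        ≤ ∑ i, closeRank t (fun j => (x j).1) (fun j => (x j).2) i i} := by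
    ext x; simp
  rw [this]
  refine MeasurableSet.biUnion (Set.to_countable _) fun t _ => measurableSet_le measurable_const ?_
  exact Finset.measurable_sum _ fun i _ => measurable_closeRank_pair t i

instance : IsProbabilityMeasure stdGauss := by unfold stdGauss; infer_instance
instance : NullSingletonClass stdGauss := nullSingletonClass_gaussianReal one_ne_zero
instance : IsProbabilityMeasure stdGauss2 := by unfold stdGauss2; infer_instance

lemma strictMono_Phi : StrictMono Phi := by
  intro a b hab
  have hpos : stdGauss (Set.Ioc a b) ≠ 0 := by
    intro h
    have := gaussianReal_absolutelyContinuous' 0 one_ne_zero h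
    simp only [Real.volume_Ioc, ENNReal.ofReal_eq_zero] at this
    linarith
  have hreal : 0 < stdGauss.real (Set.Ioc a b) :=
    ENNReal.toReal_pos hpos (measure_ne_top _ _)
  have h := measureReal_union (μ := stdGauss) (Set.Iic_disjoint_Ioc (le_refl a) (c := b))
    measurableSet_Ioc
  rw [Set.Iic_union_Ioc_eq_Iic hab.le] at h
  change stdGauss.real _ < stdGauss.real _
  linarith

lemma Phi_mem_Ioo (t : ℝ) : Phi t ∈ Set.Ioo (0 : ℝ) 1 := by
  constructor
  · exact lt_of_le_of_lt (b := Phi (t - 1)) ENNReal.toReal_nonneg (strictMono_Phi (by linarith))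
  · exact lt_of_lt_of_le (b := Phi (t + 1)) (strictMono_Phi (by linarith)) measureReal_le_one

lemma strictMono_invFun_Phi {F : ℝ → ℝ} (hF_mono : StrictMono F) (hF_cont : Continuous F)
    (hF_bot : Tendsto F atBot (𝓝 0)) (hF_top : Tendsto F atTop (𝓝 1)) :
    StrictMono fun t => Function.invFun F (Phi t) := by
  have hinv : ∀ t, F (Function.invFun F (Phi t)) = Phi t := by
    intro t
    refine Function.invFun_eq ?_
    obtain ⟨a, ha⟩ := (hF_bot.eventually (gt_mem_nhds (Phi_mem_Ioo t).1)).exists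
    obtain ⟨b, hb⟩ := (hF_top.eventually (lt_mem_nhds (Phi_mem_Ioo t).2)).exists
    exact mem_range_of_exists_le_of_exists_ge hF_cont ⟨a, ha.le⟩ ⟨b, hb.le⟩
  intro s t hst
  rw [← hF_mono.lt_iff_lt, hinv, hinv]
  exact strictMono_Phi hst

lemma HCrank_map_of_strictMono {f g : ℝ → ℝ} (hf : StrictMono f) (hg : StrictMono g)
    (z : Fin n → ℝ × ℝ) : HCrank n (fun i => (f (z i).1, g (z i).2)) = HCrank n z := by
  simp only [HCrank, rankDiff, rankOf_comp_strictMono hf fun j => (z j).1,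
    rankOf_comp_strictMono hg fun j => (z j).2]
  congr!

/-- The data obtained from independent standard normal pairs and contamination labels `c`. -/
def contaminate (ρ : ℝ) (c : Fin n → Bool) (z : Fin n → ℝ × ℝ) : Fin n → ℝ × ℝ :=
  fun i => ((z i).1, if c i = true then ρ * (z i).1 + √(1 - ρ ^ 2) * (z i).2 else (z i).2)

/-- Permute the second coordinates. -/
def permSnd (σ : Equiv.Perm (Fin n)) (z : Fin n → ℝ × ℝ) : Fin n → ℝ × ℝ :=
  fun i => ((z i).1, (z (σ i)).2)

lemma measurePreserving_permSnd (σ : Equiv.Perm (Fin n)) :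
    MeasurePreserving (permSnd σ) (iid n stdGauss2) (iid n stdGauss2) := by
  have e := measurePreserving_arrowProdEquivProdArrow ℝ ℝ (Fin n) (fun _ => stdGauss)
    (fun _ => stdGauss)
  have hσ := measurePreserving_piCongrLeft (fun _ : Fin n => stdGauss) σ.symm
  have := (e.symm _).comp (((MeasurePreserving.id (Measure.pi fun _ : Fin n => stdGauss)).prod
    hσ).comp e)
  convert! this using 1
  ext z i
  · rfl
  · change (z (σ i)).2 = MeasurableEquiv.piCongrLeft (fun _ => ℝ) σ.symm (fun j => (z j).2) i
    have := MeasurableEquiv.piCongrLeft_apply_apply (β := fun _ => ℝ) σ.symm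
      (fun j => (z j).2) (σ i)
    simpa using this.symm

lemma measurable_contaminate (ρ : ℝ) :
    Measurable fun p : (Fin n → Bool) × (Fin n → ℝ × ℝ) => contaminate ρ p.1 p.2 := by
  refine measurable_pi_lambda _ fun i => Measurable.prodMk (by fun_prop) ?_
  refine Measurable.ite ?_ (by fun_prop) (by fun_prop)
  exact (by fun_prop : Measurable fun p : (Fin n → Bool) × (Fin n → ℝ × ℝ) => p.1 i)
    (measurableSet_singleton true)

lemma map_linear_stdGauss2 {ρ : ℝ} (h0 : 0 ≤ ρ) (h1 : ρ ≤ 1) :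
    stdGauss2.map (fun z => ρ * z.1 + √(1 - ρ ^ 2) * z.2) = stdGauss := by
  have hX : stdGauss2.map (fun z => ρ * z.1) = gaussianReal 0 (.mk (ρ ^ 2) (sq_nonneg _)) := by
    have h := Measure.map_map (μ := stdGauss2) (g := (ρ * ·)) (f := Prod.fst) (by fun_prop)
      (by fun_prop)
    refine h.symm.trans ?_
    simp [stdGauss2, stdGauss, gaussianReal_map_const_mul]
  have hY : stdGauss2.map (fun z => √(1 - ρ ^ 2) * z.2)
      = gaussianReal 0 (.mk (√(1 - ρ ^ 2) ^ 2) (sq_nonneg _)) := by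
    have h := Measure.map_map (μ := stdGauss2) (g := (√(1 - ρ ^ 2) * ·)) (f := Prod.snd)
      (by fun_prop) (by fun_prop)
    refine h.symm.trans ?_
    simp [stdGauss2, stdGauss, gaussianReal_map_const_mul]
  have hind : IndepFun (fun z : ℝ × ℝ => ρ * z.1) (fun z => √(1 - ρ ^ 2) * z.2) stdGauss2 :=
    indepFun_prod (X := (ρ * ·)) (Y := (√(1 - ρ ^ 2) * ·)) (by fun_prop) (by fun_prop)
  have := gaussianReal_add_gaussianReal_of_indepFun hind hX hY
  refine this.trans ?_
  unfold stdGauss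
  congr 1
  · simp
  · have : 0 ≤ 1 - ρ ^ 2 := by nlinarith
    apply NNReal.eq
    change ρ ^ 2 + √(1 - ρ ^ 2) ^ 2 = 1
    rw [Real.sq_sqrt this]
    ring

lemma ae_injective_pi_stdGauss :
    ∀ᵐ x ∂(Measure.pi fun _ : Fin n => stdGauss), Function.Injective x := by
  have hne : ∀ i j : Fin n, i ≠ j →
      ∀ᵐ x ∂(Measure.pi fun _ : Fin n => stdGauss), x i ≠ x j := by
    intro i j hij
    have hind : IndepFun (fun x : Fin n → ℝ => x i) (fun x => x j)
        (Measure.pi fun _ : Fin n => stdGauss) :=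
      (iIndepFun_pi (μ := fun _ : Fin n => stdGauss) (X := fun _ => id)
        fun _ => aemeasurable_id).indepFun hij
    have hlaw := (indepFun_iff_map_prod_eq_prod_map_map (measurable_pi_apply i).aemeasurable
      (measurable_pi_apply j).aemeasurable).mp hind
    rw [(measurePreserving_eval (fun _ : Fin n => stdGauss) i).map_eq,
      (measurePreserving_eval (fun _ : Fin n => stdGauss) j).map_eq] at hlaw
    have hdiag : MeasurableSet {p : ℝ × ℝ | p.1 = p.2} :=
      measurableSet_eq_fun measurable_fst measurable_snd
    have hnull : (stdGauss.prod stdGauss) {p : ℝ × ℝ | p.1 = p.2} = 0 := by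
      rw [Measure.measure_prod_null hdiag]
      refine Filter.Eventually.of_forall fun x => ?_
      have : Prod.mk x ⁻¹' {p : ℝ × ℝ | p.1 = p.2} = {x} := by ext y; simp [eq_comm]
      simp [this]
    rw [← hlaw, Measure.map_apply (by fun_prop) hdiag] at hnull
    simpa [ae_iff] using hnull
  have : ∀ᵐ x ∂(Measure.pi fun _ : Fin n => stdGauss), ∀ i j : Fin n, i ≠ j → x i ≠ x j := by
    simp only [ae_all_iff]
    exact hne
  filter_upwards [this] with x hx i j
  exact not_imp_not.mp (hx i j)

lemma map_iid_stdGauss2 {g : Fin n → ℝ × ℝ → ℝ} (hg : ∀ i, Measurable (g i))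
    (h : ∀ i, stdGauss2.map (g i) = stdGauss) :
    MeasurePreserving (fun z i => g i (z i)) (iid n stdGauss2)
      (Measure.pi fun _ : Fin n => stdGauss) := by
  refine ⟨by fun_prop, ?_⟩
  have : ∀ i, SigmaFinite (stdGauss2.map (g i)) := fun i => by rw [h]; infer_instance
  rw [iid, Measure.pi_map_pi fun i => (hg i).aemeasurable]
  simp only [h]

lemma map_fst_stdGauss2 : stdGauss2.map (fun z => z.1) = stdGauss := by
  simp [stdGauss2]

lemma map_snd_stdGauss2 : stdGauss2.map (fun z => z.2) = stdGauss := by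
  simp [stdGauss2]

lemma map_contaminate_snd_stdGauss2 {ρ : ℝ} (h0 : 0 ≤ ρ) (h1 : ρ ≤ 1) (b : Bool) :
    stdGauss2.map (fun z => if b = true then ρ * z.1 + √(1 - ρ ^ 2) * z.2 else z.2)
      = stdGauss := by
  cases b
  · simpa using map_snd_stdGauss2
  · simpa using map_linear_stdGauss2 h0 h1

lemma ae_injective_contaminate {ρ : ℝ} (h0 : 0 ≤ ρ) (h1 : ρ ≤ 1) (c : Fin n → Bool) :
    ∀ᵐ z ∂(iid n stdGauss2), Function.Injective (fun i => (contaminate ρ c z i).1)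
      ∧ Function.Injective (fun i => (contaminate ρ c z i).2) := by
  have hX := map_iid_stdGauss2 (n := n) (fun _ => measurable_fst) (fun _ => map_fst_stdGauss2)
  have hY := map_iid_stdGauss2 (n := n)
    (g := fun i z => if c i = true then ρ * z.1 + √(1 - ρ ^ 2) * z.2 else z.2)
    (fun i => by split_ifs <;> fun_prop) (fun i => map_contaminate_snd_stdGauss2 h0 h1 (c i))
  exact (hX.quasiMeasurePreserving.ae ae_injective_pi_stdGauss).and
    (hY.quasiMeasurePreserving.ae ae_injective_pi_stdGauss)

/-- The law of a contamination label. -/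
def labelMeasure (ε : ℝ) : Measure Bool :=
  ENNReal.ofReal (1 - ε) • Measure.dirac false + ENNReal.ofReal ε • Measure.dirac true

lemma isProbabilityMeasure_labelMeasure {ε : ℝ} (h0 : 0 ≤ ε) (h1 : ε ≤ 1) :
    IsProbabilityMeasure (labelMeasure ε) := by
  refine ⟨?_⟩
  simp only [labelMeasure, Measure.coe_add, Measure.coe_smul, Pi.add_apply, Pi.smul_apply,
    measure_univ, smul_eq_mul, mul_one]
  rw [← ENNReal.ofReal_add (by linarith) h0]
  simp

lemma biNormal_zero : biNormal 0 = stdGauss2 := by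
  simp [biNormal]

lemma mixture_eq_map {ε : ℝ} (ρ : ℝ) :
    mixture ε ρ = ((labelMeasure ε).prod stdGauss2).map fun p =>
      (p.2.1, if p.1 = true then ρ * p.2.1 + √(1 - ρ ^ 2) * p.2.2 else p.2.2) := by
  have hm : Measurable fun p : Bool × ℝ × ℝ =>
      (p.2.1, if p.1 = true then ρ * p.2.1 + √(1 - ρ ^ 2) * p.2.2 else p.2.2) := by
    refine Measurable.prodMk (by fun_prop) (Measurable.ite ?_ (by fun_prop) (by fun_prop))
    exact measurable_fst (measurableSet_singleton true)
  rw [labelMeasure, Measure.add_prod, Measure.map_add _ _ hm]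
  simp only [Measure.prod_smul_left, Measure.map_smul, Measure.dirac_prod]
  rw [Measure.map_map hm (by fun_prop), Measure.map_map hm (by fun_prop), mixture, biNormal_zero]
  congr 2
  simp [Function.comp_def]

lemma iid_mixture_eq_map {ε : ℝ} (h0 : 0 ≤ ε) (h1 : ε ≤ 1) (ρ : ℝ) :
    iid n (mixture ε ρ) = ((Measure.pi fun _ : Fin n => labelMeasure ε).prod
      (iid n stdGauss2)).map fun p => contaminate ρ p.1 p.2 := by
  have := isProbabilityMeasure_labelMeasure h0 h1
  have e := measurePreserving_arrowProdEquivProdArrow Bool (ℝ × ℝ) (Fin n)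
    (fun _ => labelMeasure ε) (fun _ => stdGauss2)
  have hm : Measurable fun p : Bool × ℝ × ℝ =>
      (p.2.1, if p.1 = true then ρ * p.2.1 + √(1 - ρ ^ 2) * p.2.2 else p.2.2) := by
    refine Measurable.prodMk (by fun_prop) (Measurable.ite ?_ (by fun_prop) (by fun_prop))
    exact measurable_fst (measurableSet_singleton true)
  have : IsProbabilityMeasure (((labelMeasure ε).prod stdGauss2).map fun p =>
      (p.2.1, if p.1 = true then ρ * p.2.1 + √(1 - ρ ^ 2) * p.2.2 else p.2.2)) :=
    Measure.isProbabilityMeasure_map hm.aemeasurable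
  simp only [iid, mixture_eq_map]
  rw [← Measure.pi_map_pi fun _ => hm.aemeasurable]
  have e' := e.map_eq
  rw [← e', Measure.map_map (measurable_contaminate ρ) e.measurable]
  rfl

end Measures

section Displacement

lemma abs_Phi_sub_Phi_le (a b : ℝ) : |Phi a - Phi b| ≤ |a - b| := by
  have key : ∀ a b : ℝ, a ≤ b → Phi b - Phi a ≤ b - a := by
    intro a b hab
    have h := measureReal_union (μ := stdGauss) (Set.Iic_disjoint_Ioc (le_refl a) (c := b))
      measurableSet_Ioc
    rw [Set.Iic_union_Ioc_eq_Iic hab] at h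
    have hpdf : ∀ x, gaussianPDF 0 1 x ≤ 1 := by
      intro x
      rw [gaussianPDF, ENNReal.ofReal_le_one, gaussianPDFReal]
      have h1 : (√(2 * π * ((1 : NNReal) : ℝ)))⁻¹ ≤ 1 := by
        refine inv_le_one_of_one_le₀ (Real.one_le_sqrt.mpr ?_)
        have := Real.pi_gt_three
        simp only [NNReal.coe_one]
        linarith
      refine mul_le_one₀ h1 (Real.exp_pos _).le (Real.exp_le_one_iff.mpr ?_)
      simp only [NNReal.coe_one]
      have := sq_nonneg (x - 0)
      rw [neg_div]
      linarith [div_nonneg this (by norm_num : (0 : ℝ) ≤ 2 * 1)]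
    have hle : stdGauss (Set.Ioc a b) ≤ ENNReal.ofReal (b - a) := by
      rw [stdGauss, gaussianReal_apply 0 one_ne_zero]
      calc _ ≤ ∫⁻ _ in Set.Ioc a b, 1 := lintegral_mono hpdf
        _ = _ := by simp
    have := ENNReal.toReal_mono ENNReal.ofReal_ne_top hle
    rw [ENNReal.toReal_ofReal (by linarith)] at this
    change stdGauss.real _ - stdGauss.real _ ≤ _
    rw [h]
    simpa [Measure.real] using this
  rcases le_total a b with hab | hab
  · rw [abs_sub_comm, abs_sub_comm a b, abs_of_nonneg (by linarith : 0 ≤ b - a),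
      abs_of_nonneg (sub_nonneg.mpr (strictMono_Phi.monotone hab))]
    exact key a b hab
  · rw [abs_of_nonneg (by linarith : 0 ≤ a - b),
      abs_of_nonneg (sub_nonneg.mpr (strictMono_Phi.monotone hab))]
    exact key b a hab

lemma integral_sq_stdGauss : ∫ x, x ^ 2 ∂stdGauss = 1 := by
  have h := variance_eq_sub (memLp_id_gaussianReal' (μ := 0) (v := 1) 2 (by simp))
  rw [variance_id_gaussianReal] at h
  simp only [id, Pi.pow_apply, integral_id_gaussianReal] at h
  simpa [stdGauss] using h.symm

lemma integrable_sq_stdGauss : Integrable (fun x : ℝ => x ^ 2) stdGauss :=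
  (memLp_id_gaussianReal' (μ := 0) (v := 1) 2 (by simp)).integrable_sq

lemma lintegral_quadratic_stdGauss2 {a b c : ℝ} (ha : 0 ≤ a) (hb : 0 ≤ b) (hc : 0 ≤ c) :
    ∫⁻ p, ENNReal.ofReal (a + (b * p.1 ^ 2 + c * p.2 ^ 2)) ∂stdGauss2
      = ENNReal.ofReal (a + (b + c)) := by
  have i1 : Integrable (fun p : ℝ × ℝ => b * p.1 ^ 2) stdGauss2 :=
    (integrable_sq_stdGauss.comp_fst stdGauss).const_mul b
  have i2 : Integrable (fun p : ℝ × ℝ => c * p.2 ^ 2) stdGauss2 :=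
    (integrable_sq_stdGauss.comp_snd stdGauss).const_mul c
  have i3 : Integrable (fun p : ℝ × ℝ => b * p.1 ^ 2 + c * p.2 ^ 2) stdGauss2 := i1.add i2
  have i4 : Integrable (fun p : ℝ × ℝ => a + (b * p.1 ^ 2 + c * p.2 ^ 2)) stdGauss2 :=
    (integrable_const a).add i3
  rw [← ofReal_integral_eq_lintegral_ofReal i4 (ae_of_all _ fun p => by positivity)]
  congr 1
  rw [integral_add (integrable_const a) i3, integral_add i1 i2, integral_const_mul,
    integral_const_mul]
  have e1 : ∫ p : ℝ × ℝ, p.1 ^ 2 ∂stdGauss2 = 1 := by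
    rw [stdGauss2, integral_fun_fst (μ := stdGauss) (ν := stdGauss) (fun x => x ^ 2)]
    simp [integral_sq_stdGauss]
  have e2 : ∫ p : ℝ × ℝ, p.2 ^ 2 ∂stdGauss2 = 1 := by
    rw [stdGauss2, integral_fun_snd (μ := stdGauss) (ν := stdGauss) (fun x => x ^ 2)]
    simp [integral_sq_stdGauss]
  simp [e1, e2]

/-- The difference of the indicators of `p.1 ≤ a` and `h p ≤ b`. -/
def thresholdDiff (h : ℝ × ℝ → ℝ) (a b : ℝ) (p : ℝ × ℝ) : ℝ :=
  (if p.1 ≤ a then 1 else 0) - (if h p ≤ b then 1 else 0)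

lemma abs_thresholdDiff_le (h : ℝ × ℝ → ℝ) (a b : ℝ) (p : ℝ × ℝ) :
    |thresholdDiff h a b p| ≤ 1 := by
  unfold thresholdDiff; split_ifs <;> simp

lemma measurable_thresholdDiff {h : ℝ × ℝ → ℝ} (hh : Measurable h) :
    Measurable fun q : (ℝ × ℝ) × (ℝ × ℝ) => thresholdDiff h q.1.1 q.1.2 q.2 := by
  unfold thresholdDiff
  exact (Measurable.ite (measurableSet_le (by fun_prop) (by fun_prop)) measurable_const
    measurable_const).sub (Measurable.ite (measurableSet_le (by fun_prop) (by fun_prop))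
      measurable_const measurable_const)

lemma integral_ite_le {h : ℝ × ℝ → ℝ} (hh : Measurable h) (hlaw : stdGauss2.map h = stdGauss)
    (a : ℝ) : Integrable (fun p => if h p ≤ a then (1 : ℝ) else 0) stdGauss2 ∧
      ∫ p, (if h p ≤ a then (1 : ℝ) else 0) ∂stdGauss2 = Phi a := by
  have hm : MeasurableSet (h ⁻¹' Set.Iic a) := hh measurableSet_Iic
  have e : (fun p => if h p ≤ a then (1 : ℝ) else 0) = (h ⁻¹' Set.Iic a).indicator 1 := by
    ext p
    by_cases hp : h p ≤ a
    · rw [if_pos hp, Set.indicator_of_mem (show p ∈ h ⁻¹' Set.Iic a from hp), Pi.one_apply]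
    · rw [if_neg hp, Set.indicator_of_notMem (show p ∉ h ⁻¹' Set.Iic a from hp)]
  rw [e]
  refine ⟨(integrable_const (1 : ℝ)).indicator hm, ?_⟩
  rw [integral_indicator_one hm, Phi, ← hlaw, Measure.map_apply hh measurableSet_Iic]
  rfl

lemma integral_thresholdDiff {h : ℝ × ℝ → ℝ} (hh : Measurable h)
    (hlaw : stdGauss2.map h = stdGauss) (a b : ℝ) :
    ∫ p, thresholdDiff h a b p ∂stdGauss2 = Phi a - Phi b := by
  have h1 := integral_ite_le measurable_fst map_fst_stdGauss2 a
  have h2 := integral_ite_le hh hlaw b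
  unfold thresholdDiff
  rw [integral_sub h1.1 h2.1, h1.2, h2.2]

lemma memLp_thresholdDiff {h : ℝ × ℝ → ℝ} (hh : Measurable h) (a b : ℝ) :
    MemLp (thresholdDiff h a b) 2 stdGauss2 :=
  MemLp.of_bound ((measurable_thresholdDiff hh).comp
    (f := fun p => ((a, b), p)) (by fun_prop)).aestronglyMeasurable 1
    (ae_of_all _ fun p => abs_thresholdDiff_le h a b p)

lemma lintegral_sq_sum_thresholdDiff_le {m : ℕ} {h : Fin m → ℝ × ℝ → ℝ}
    (hh : ∀ j, Measurable (h j)) (hlaw : ∀ j, stdGauss2.map (h j) = stdGauss) (a b : ℝ) :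
    ∫⁻ z, ENNReal.ofReal ((∑ j, thresholdDiff (h j) a b (z j)) ^ 2) ∂(iid m stdGauss2)
      ≤ ENNReal.ofReal (m + (m * (a - b)) ^ 2) := by
  unfold iid
  set P := Measure.pi fun _ : Fin m => stdGauss2
  have hmem : ∀ j, MemLp (fun z : Fin m → ℝ × ℝ => thresholdDiff (h j) a b (z j)) 2 P :=
    fun j => (memLp_thresholdDiff (hh j) a b).comp_measurePreserving
      (measurePreserving_eval (fun _ : Fin m => stdGauss2) j)
  have hmemS : MemLp (∑ j, fun z : Fin m → ℝ × ℝ => thresholdDiff (h j) a b (z j)) 2 P :=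
    memLp_finsetSum' _ fun j _ => hmem j
  have hvar := variance_sum_pi (μ := fun _ : Fin m => stdGauss2)
    (fun j => memLp_thresholdDiff (hh j) a b)
  have hvar1 : ∀ j, Var[thresholdDiff (h j) a b; stdGauss2] ≤ 1 := by
    intro j
    refine (variance_le_expectation_sq (memLp_thresholdDiff (hh j) a b).aestronglyMeasurable).trans
      ?_
    calc _ ≤ ∫ _, (1 : ℝ) ∂stdGauss2 := by
          refine integral_mono (memLp_thresholdDiff (hh j) a b).integrable_sq
            (integrable_const _) fun p => ?_
          exact (sq_le_one_iff_abs_le_one _).mpr (abs_thresholdDiff_le (h j) a b p)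
      _ = 1 := by simp
  have hmean : P[∑ j, fun z : Fin m → ℝ × ℝ => thresholdDiff (h j) a b (z j)]
      = m * (Phi a - Phi b) := by
    simp only [Finset.sum_apply]
    rw [integral_finsetSum _ fun j _ => (hmem j).integrable (by norm_num)]
    have : ∀ j, ∫ z, thresholdDiff (h j) a b (z j) ∂P = Phi a - Phi b := by
      intro j
      rw [← integral_thresholdDiff (hh j) (hlaw j) a b,
        ← (measurePreserving_eval (fun _ : Fin m => stdGauss2) j).map_eq,
        integral_map (measurable_pi_apply j).aemeasurable
          (by rw [(measurePreserving_eval (fun _ : Fin m => stdGauss2) j).map_eq]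
              exact (memLp_thresholdDiff (hh j) a b).aestronglyMeasurable)]
    simp [this]
    ring
  have hsq := variance_eq_sub hmemS
  rw [hmean, hvar] at hsq
  have hS : ∑ j, Var[thresholdDiff (h j) a b; stdGauss2] ≤ m := by
    calc _ ≤ ∑ _j : Fin m, (1 : ℝ) := Finset.sum_le_sum fun j _ => hvar1 j
      _ = m := by simp
  have hPhi : (m * (Phi a - Phi b)) ^ 2 ≤ (m * (a - b)) ^ 2 := by
    rw [mul_pow, mul_pow]
    exact mul_le_mul_of_nonneg_left (sq_le_sq.mpr (abs_Phi_sub_Phi_le a b)) (sq_nonneg _)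
  have hi := hmemS.integrable_sq
  simp only [Finset.sum_apply, Pi.pow_apply] at hi hsq
  rw [← ofReal_integral_eq_lintegral_ofReal hi (ae_of_all _ fun z => sq_nonneg _)]
  exact ENNReal.ofReal_le_ofReal (by linarith)

lemma rankOf_sub_rankOf {m : ℕ} (h : Fin (m + 1) → ℝ × ℝ → ℝ) (z : Fin (m + 1) → ℝ × ℝ)
    (i : Fin (m + 1)) :
    (rankOf (m + 1) (fun j => (z j).1) i : ℝ) - rankOf (m + 1) (fun j => h j (z j)) i
      = ∑ j, thresholdDiff (h (i.succAbove j)) (z i).1 (h i (z i)) (z (i.succAbove j)) := by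
  simp only [rankOf, Finset.card_filter, Nat.cast_sum, thresholdDiff]
  rw [← Finset.sum_sub_distrib, Fin.sum_univ_succAbove _ i]
  simp

lemma lintegral_sq_rankOf_sub_rankOf_le {n : ℕ} {ρ : ℝ} (h0 : 0 ≤ ρ) (h1 : ρ ≤ 1)
    (c : Fin n → Bool) {i : Fin n} (hi : c i = true) :
    ∫⁻ z, ENNReal.ofReal (((rankOf n (fun j => (contaminate ρ c z j).1) i : ℝ)
        - rankOf n (fun j => (contaminate ρ c z j).2) i) ^ 2) ∂(iid n stdGauss2)
      ≤ ENNReal.ofReal (n + 4 * n ^ 2 * (1 - ρ)) := by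
  obtain _ | m := n
  · exact i.elim0
  let h : Fin (m + 1) → ℝ × ℝ → ℝ := fun j p =>
    if c j = true then ρ * p.1 + √(1 - ρ ^ 2) * p.2 else p.2
  have hh : ∀ j, Measurable (h j) := fun j => by
    simp only [h]; split_ifs <;> fun_prop
  have hlaw : ∀ j, stdGauss2.map (h j) = stdGauss := fun j =>
    map_contaminate_snd_stdGauss2 h0 h1 (c j)
  let f : (ℝ × ℝ) × (Fin m → ℝ × ℝ) → ENNReal := fun q =>
    ENNReal.ofReal ((∑ j, thresholdDiff (h (i.succAbove j)) q.1.1 (h i q.1) (q.2 j)) ^ 2)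
  have hf : Measurable f := by
    refine ENNReal.measurable_ofReal.comp (Measurable.pow_const ?_ 2)
    refine Finset.measurable_sum _ fun j _ => ?_
    have := hh i
    exact (measurable_thresholdDiff (hh (i.succAbove j))).comp
      (f := fun q : (ℝ × ℝ) × (Fin m → ℝ × ℝ) => ((q.1.1, h i q.1), q.2 j)) (by fun_prop)
  have e := measurePreserving_piFinSuccAbove (fun _ : Fin (m + 1) => stdGauss2) i
  calc _ = ∫⁻ z, f (MeasurableEquiv.piFinSuccAbove (fun _ => ℝ × ℝ) i z)
            ∂(iid (m + 1) stdGauss2) := by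
        refine lintegral_congr fun z => ?_
        simp only [f]
        congr 2
        exact rankOf_sub_rankOf h z i
    _ = ∫⁻ q, f q ∂(stdGauss2.prod (Measure.pi fun _ : Fin m => stdGauss2)) :=
        e.lintegral_comp hf
    _ = ∫⁻ p, ∫⁻ z, f (p, z) ∂(Measure.pi fun _ : Fin m => stdGauss2) ∂stdGauss2 :=
        lintegral_prod _ hf.aemeasurable
    _ ≤ ∫⁻ p, ENNReal.ofReal (m + (2 * m ^ 2 * (1 - ρ) ^ 2 * p.1 ^ 2
          + 2 * m ^ 2 * (1 - ρ ^ 2) * p.2 ^ 2)) ∂stdGauss2 := by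
        refine lintegral_mono fun p => ?_
        refine (lintegral_sq_sum_thresholdDiff_le (fun j => hh (i.succAbove j))
          (fun j => hlaw (i.succAbove j)) p.1 (h i p)).trans (ENNReal.ofReal_le_ofReal ?_)
        have hs : √(1 - ρ ^ 2) ^ 2 = 1 - ρ ^ 2 := Real.sq_sqrt (by nlinarith)
        simp only [h, hi, if_true]
        rw [mul_pow]
        have : (p.1 - (ρ * p.1 + √(1 - ρ ^ 2) * p.2)) ^ 2
            ≤ 2 * (1 - ρ) ^ 2 * p.1 ^ 2 + 2 * √(1 - ρ ^ 2) ^ 2 * p.2 ^ 2 := by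
          nlinarith [sq_nonneg ((1 - ρ) * p.1 + √(1 - ρ ^ 2) * p.2)]
        rw [hs] at this
        nlinarith [mul_le_mul_of_nonneg_left this (sq_nonneg (m : ℝ))]
    _ = ENNReal.ofReal (m + (2 * m ^ 2 * (1 - ρ) ^ 2 + 2 * m ^ 2 * (1 - ρ ^ 2))) := by
        refine lintegral_quadratic_stdGauss2 (by positivity) (by positivity) ?_
        have : 0 ≤ 1 - ρ ^ 2 := by nlinarith
        positivity
    _ ≤ _ := by
        refine ENNReal.ofReal_le_ofReal ?_
        push_cast
        have : 0 ≤ 1 - ρ := by linarith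
        have hm : (0 : ℝ) ≤ m := Nat.cast_nonneg m
        have e1 : (m : ℝ) + (2 * m ^ 2 * (1 - ρ) ^ 2 + 2 * m ^ 2 * (1 - ρ ^ 2))
          = m + 4 * m ^ 2 * (1 - ρ) := by ring
        rw [e1]
        have : (m : ℝ) ^ 2 * (1 - ρ) ≤ (m + 1) ^ 2 * (1 - ρ) :=
          mul_le_mul_of_nonneg_right (by nlinarith) this
        linarith

end Displacement

section TailBounds

variable {n : ℕ}

instance (n : ℕ) : IsProbabilityMeasure (iid n stdGauss2) := by unfold iid; infer_instance

lemma contaminate_permSnd_snd (ρ : ℝ) {c : Fin n → Bool} {σ : Equiv.Perm (Fin n)}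
    (hσ : ∀ i, c i = true → σ i = i) (z : Fin n → ℝ × ℝ) (j : Fin n) :
    (contaminate ρ c (permSnd σ z) j).2 = (contaminate ρ c z (σ j)).2 := by
  by_cases hc : c j = true
  · simp [contaminate, permSnd, hc, hσ j hc]
  · have hc' : c (σ j) ≠ true := fun h => hc (σ.injective (hσ _ h) ▸ h)
    simp [contaminate, permSnd, hc, hc']

lemma closeRank_contaminate_permSnd (t : ℕ) (ρ : ℝ) {c : Fin n → Bool}
    {σ : Equiv.Perm (Fin n)} (hσ : ∀ i, c i = true → σ i = i) (z : Fin n → ℝ × ℝ) (i : Fin n) :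
    closeRank t (fun j => (contaminate ρ c (permSnd σ z) j).1)
        (fun j => (contaminate ρ c (permSnd σ z) j).2) i i
      = closeRank t (fun j => (contaminate ρ c z j).1) (fun j => (contaminate ρ c z j).2)
          i (σ i) := by
  simp only [contaminate_permSnd_snd ρ hσ z]
  unfold closeRank
  rw [rankOf_comp (fun j => (contaminate ρ c z j).2) σ i]
  rfl

lemma contaminate_false (ρ : ℝ) (z : Fin n → ℝ × ℝ) : contaminate ρ (fun _ => false) z = z :=
  funext fun i => by simp [contaminate]

lemma measureReal_sum_closeRank_ge_le (hn : 4 ≤ n) {t : ℕ} (ht : t ≤ n / 2) {L : ℝ}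
    (hL : 0 ≤ L) :
    (iid n stdGauss2).real {z | n * nullCdf n t + L * √(n * nullCdf n t * (1 - nullCdf n t))
        ≤ ∑ i, closeRank t (fun j => (z j).1) (fun j => (z j).2) i i}
      ≤ rexp (1 / 12 - L / 24) := by
  classical
  obtain ⟨hμ1, -, hu⟩ := mul_nullCdf_bounds hn ht
  have : Nonempty (Fin n) := ⟨⟨0, by omega⟩⟩
  refine measureReal_le_of_card_le (T := permSnd) measurePreserving_permSnd
    (measurableSet_le measurable_const
      (Finset.measurable_sum _ fun i _ => measurable_closeRank_pair t i)) ?_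
  filter_upwards [ae_injective_contaminate le_rfl zero_le_one (fun _ : Fin n => false)]
    with z ⟨hx, hy⟩
  set μ : ℝ := n * nullCdf n t
  have hmean : permMean (closeRank t (fun j => (contaminate 0 (fun _ => false) z j).1)
      (fun j => (contaminate 0 (fun _ => false) z j).2)) = μ := by
    rw [permMean, sum_sum_closeRank_eq_nullCdf (by omega) (by omega) hx hy, Fintype.card_fin]
    have : (n : ℝ) ≠ 0 := by positivity
    exact mul_div_cancel_left₀ μ this
  have hμs : 1 ≤ √μ := Real.one_le_sqrt.mpr hμ1
  have hsq : √μ ^ 2 = μ := Real.sq_sqrt (by linarith)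
  have hθ : (1 / (6 * √μ)) ≤ 1 / 6 := by
    apply one_div_le_one_div_of_le <;> linarith
  have h := card_le_permSum _ (closeRank_nonneg t (fun j => (contaminate 0 (fun _ => false) z j).1)
    (fun j => (contaminate 0 (fun _ => false) z j).2)) (closeRank_le_one t _ _)
    (L * √(μ * (1 - nullCdf n t))) (by positivity) hθ
  rw [hmean] at h
  refine le_trans (le_of_eq ?_) (h.trans (mul_le_mul_of_nonneg_left (Real.exp_le_exp.mpr ?_)
    (Nat.cast_nonneg _)))
  · congr 3
    ext σ
    have e : ∀ i, closeRank t (fun j => (permSnd σ z j).1) (fun j => (permSnd σ z j).2) i i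
        = closeRank t (fun j => (contaminate 0 (fun _ => false) z j).1)
          (fun j => (contaminate 0 (fun _ => false) z j).2) i (σ i) := fun i => by
      rw [← closeRank_contaminate_permSnd t 0 (by simp) z i, contaminate_false]
    simp only [permSum, e]
  · rw [Real.sqrt_mul (by linarith : 0 ≤ μ)]
    have hq : 1 / 4 ≤ √(1 - nullCdf n t) :=
      Real.le_sqrt_of_sq_le (by norm_num; linarith)
    have e1 : 3 * (1 / (6 * √μ)) ^ 2 * μ = 1 / 12 := by
      rw [← hsq, Real.sqrt_sq (by linarith)]
      field_simp
      norm_num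
    have e2 : 1 / (6 * √μ) * (L * (√μ * √(1 - nullCdf n t))) = L * √(1 - nullCdf n t) / 6 := by
      field_simp
    rw [e1, e2]
    nlinarith

lemma measureReal_le_HCrank_le (hn : 4 ≤ n) {L : ℝ} (hL : 0 ≤ L) :
    (iid n stdGauss2).real {z | L ≤ HCrank n z} ≤ n * rexp (1 / 12 - L / 24) := by
  have hsub : {z : Fin n → ℝ × ℝ | L ≤ HCrank n z} = ⋃ t ∈ Finset.range (n / 2 + 1),
      {z | n * nullCdf n t + L * √(n * nullCdf n t * (1 - nullCdf n t))
        ≤ ∑ i, closeRank t (fun j => (z j).1) (fun j => (z j).2) i i} := by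
    ext z
    simp [le_HCrank_iff hn]
  rw [hsub]
  refine (measureReal_biUnion_finset_le _ _).trans ?_
  calc _ ≤ ∑ t ∈ Finset.range (n / 2 + 1), rexp (1 / 12 - L / 24) :=
        Finset.sum_le_sum fun t ht => measureReal_sum_closeRank_ge_le hn
          (Nat.lt_succ_iff.mp (Finset.mem_range.mp ht)) hL
    _ ≤ _ := by
        rw [Finset.sum_const, Finset.card_range, nsmul_eq_mul]
        refine mul_le_mul_of_nonneg_right ?_ (Real.exp_pos _).le
        exact_mod_cast (by omega : n / 2 + 1 ≤ n)

lemma measurable_closeRank_contaminate (t : ℕ) (ρ : ℝ) (c : Fin n → Bool) (i : Fin n) :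
    Measurable fun z => closeRank t (fun j => (contaminate ρ c z j).1)
      (fun j => (contaminate ρ c z j).2) i i :=
  (measurable_closeRank_pair t i).comp ((measurable_contaminate ρ).comp
    (f := fun z : Fin n → ℝ × ℝ => (c, z)) (by fun_prop))

lemma measureReal_sum_uncontaminated_le (hn : 4 ≤ n) {t : ℕ} (ht : t ≤ n / 2)
    (htn : 32 * (2 * t + 1) ≤ n) {ρ : ℝ} (h0 : 0 ≤ ρ) (h1 : ρ ≤ 1) (c : Fin n → Bool) {K : ℕ}
    (hK : (Finset.univ.filter fun i => c i = true).card = K) (hK0 : 0 < K) (hKn : 2 * K ≤ n) :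
    (iid n stdGauss2).real {z | ∑ i : {i // c i = false}, closeRank t
        (fun j => (contaminate ρ c z j).1) (fun j => (contaminate ρ c z j).2) i i
          ≤ n * nullCdf n t - K / 4}
      ≤ 128 * (2 * t + 1) / K ^ 2 := by
  classical
  have hcard : (Fintype.card {i // c i = false} : ℝ) = n - K := by
    have h := Finset.card_filter_add_card_filter_not (s := (Finset.univ : Finset (Fin n)))
      (fun i => c i = true)
    simp only [Bool.not_eq_true, hK, Finset.card_univ, Fintype.card_fin] at h
    rw [Fintype.card_subtype, eq_sub_iff_add_eq']
    exact_mod_cast h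
  have hKn' : 2 * (K : ℝ) ≤ n := by exact_mod_cast hKn
  have hK0' : (0 : ℝ) < K := by exact_mod_cast hK0
  have htn' : 32 * (2 * (t : ℝ) + 1) ≤ n := by exact_mod_cast htn
  have hpos : 0 < (n : ℝ) - K := by linarith
  have : Nonempty {i // c i = false} := by
    rw [← Fintype.card_pos_iff]
    exact_mod_cast hcard ▸ hpos
  refine measureReal_le_of_card_le
    (T := fun σ : Equiv.Perm {i // c i = false} => permSnd (Equiv.Perm.ofSubtype σ))
    (fun σ => measurePreserving_permSnd _) (measurableSet_le
      (Finset.measurable_sum _ fun i _ => measurable_closeRank_contaminate t ρ c i.1)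
        measurable_const) ?_
  filter_upwards [ae_injective_contaminate h0 h1 c] with z ⟨hx, hy⟩
  set X := fun j => (contaminate ρ c z j).1
  set Y := fun j => (contaminate ρ c z j).2
  let a : {i // c i = false} → {i // c i = false} → ℝ := fun i k => closeRank t X Y i k
  have hrow : ∀ i, ∑ k, a i k ≤ 2 * t + 1 := fun i => by
    refine le_trans ?_ (sum_closeRank_le t X hy i)
    rw [sum_subtype_eq_false c (closeRank t X Y i)]
    exact Finset.sum_le_univ_sum_of_nonneg fun k => closeRank_nonneg t X Y i k
  have hmean : permMean a ≤ 2 * t + 1 := by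
    rw [permMean, div_le_iff₀ (hcard ▸ hpos)]
    calc _ ≤ ∑ _i : {i // c i = false}, (2 * (t : ℝ) + 1) := Finset.sum_le_sum fun i _ => hrow i
      _ = _ := by rw [Finset.sum_const, Finset.card_univ, nsmul_eq_mul, mul_comm]
  have hmean' : n * nullCdf n t - K / 8 ≤ permMean a := by
    rw [permMean, hcard, le_div_iff₀ hpos]
    have h := sum_sum_subtype_closeRank_ge (by omega) (by omega : t ≤ n) hx hy c
    rw [hK] at h
    have hu := (mul_nullCdf_bounds hn ht).1
    nlinarith [mul_pos hK0' hpos, mul_nonneg hK0'.le (sub_nonneg.mpr htn')]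
  have h := card_permSum_le a (fun i k => closeRank_nonneg t X Y i k)
    (fun i k => closeRank_le_one t X Y i k) (s := K / 8) (by positivity)
  refine le_trans (Nat.cast_le.mpr (Finset.card_le_card fun σ => ?_))
    (h.trans (mul_le_mul_of_nonneg_left ?_ (Nat.cast_nonneg _)))
  · have e : ∀ i : {i // c i = false},
        closeRank t (fun j => (contaminate ρ c (permSnd (Equiv.Perm.ofSubtype σ) z) j).1)
          (fun j => (contaminate ρ c (permSnd (Equiv.Perm.ofSubtype σ) z) j).2) i i
          = a i (σ i) := fun i => by
      rw [closeRank_contaminate_permSnd t ρ (fun j hj =>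
        Equiv.Perm.ofSubtype_apply_of_not_mem σ (by simp [hj])) z i,
        Equiv.Perm.ofSubtype_apply_coe]
    simp only [Finset.mem_filter, Finset.mem_univ, true_and, e, permSum]
    intro hle
    refine Finset.mem_filter.mpr ⟨Finset.mem_univ _, ?_⟩
    linarith
  · rw [div_le_div_iff₀ (by positivity) (by positivity)]
    nlinarith [mul_le_mul_of_nonneg_right hmean (sq_nonneg (K : ℝ))]

lemma measureReal_sum_contaminated_le {t : ℕ} (ht : 0 < t) {ρ : ℝ} (h0 : 0 ≤ ρ) (h1 : ρ ≤ 1)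
    (c : Fin n → Bool) {K : ℕ} (hK : (Finset.univ.filter fun i => c i = true).card = K)
    (hK0 : 0 < K) :
    (iid n stdGauss2).real {z | ∑ i with c i = true, closeRank t
        (fun j => (contaminate ρ c z j).1) (fun j => (contaminate ρ c z j).2) i i ≤ K / 2}
      ≤ 2 * (n + 4 * n ^ 2 * (1 - ρ)) / t ^ 2 := by
  set P := iid n stdGauss2
  set B : ℝ := n + 4 * n ^ 2 * (1 - ρ) with hB
  have hB0 : 0 ≤ B := by
    have : 0 ≤ 1 - ρ := by linarith
    positivity
  set V : Fin n → (Fin n → ℝ × ℝ) → ℝ := fun i z => closeRank t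
    (fun j => (contaminate ρ c z j).1) (fun j => (contaminate ρ c z j).2) i i
  have hV : ∀ i, Measurable (V i) := measurable_closeRank_contaminate t ρ c
  have hmeas : ∀ i, Measurable fun z => ENNReal.ofReal (1 - V i z) := fun i =>
    ENNReal.measurable_ofReal.comp (measurable_const.sub (hV i))
  have hone : ∀ i, c i = true → ∫⁻ z, ENNReal.ofReal (1 - V i z) ∂P
      ≤ ENNReal.ofReal (B / t ^ 2) := by
    intro i hi
    have ht2 : (0 : ℝ) < t ^ 2 := by positivity
    calc _ ≤ ∫⁻ z, ENNReal.ofReal (t ^ 2)⁻¹ * ENNReal.ofReal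
          (((rankOf n (fun j => (contaminate ρ c z j).1) i : ℝ)
            - rankOf n (fun j => (contaminate ρ c z j).2) i) ^ 2) ∂P := by
          refine lintegral_mono fun z => ?_
          rw [← ENNReal.ofReal_mul (by positivity)]
          refine ENNReal.ofReal_le_ofReal ?_
          simp only [V, closeRank]
          split_ifs with h
          · simp only [sub_self]; positivity
          · rw [sub_zero, inv_mul_eq_div, one_le_div ht2, sq_le_sq, Nat.abs_cast]
            have h' := Nat.cast_le (α := ℝ).mpr (not_le.mp h).le
            simpa [Nat.cast_natAbs] using h'
      _ = ENNReal.ofReal (t ^ 2)⁻¹ * ∫⁻ z, ENNReal.ofReal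
          (((rankOf n (fun j => (contaminate ρ c z j).1) i : ℝ)
            - rankOf n (fun j => (contaminate ρ c z j).2) i) ^ 2) ∂P :=
          lintegral_const_mul' _ _ ENNReal.ofReal_ne_top
      _ ≤ ENNReal.ofReal (t ^ 2)⁻¹ * ENNReal.ofReal B := by
          gcongr
          exact lintegral_sq_rankOf_sub_rankOf_le h0 h1 c hi
      _ = _ := by rw [← ENNReal.ofReal_mul (by positivity), inv_mul_eq_div]
  have hK0' : (0 : ℝ) < K := by exact_mod_cast hK0
  have hmarkov := mul_meas_ge_le_lintegral (μ := P)
    (f := fun z => ∑ i with c i = true, ENNReal.ofReal (1 - V i z))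
    (Finset.measurable_sum _ fun i _ => hmeas i) (ENNReal.ofReal (K / 2))
  rw [lintegral_finsetSum _ fun i _ => hmeas i] at hmarkov
  have hsum : ∑ i with c i = true, ∫⁻ z, ENNReal.ofReal (1 - V i z) ∂P
      ≤ ENNReal.ofReal (K * (B / t ^ 2)) := by
    refine (Finset.sum_le_sum fun i hi => hone i (Finset.mem_filter.mp hi).2).trans ?_
    rw [Finset.sum_const, hK, nsmul_eq_mul, ENNReal.ofReal_mul hK0'.le, ENNReal.ofReal_natCast]
  have hset : {z | ∑ i with c i = true, V i z ≤ K / 2}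
      = {z | ENNReal.ofReal (K / 2) ≤ ∑ i with c i = true, ENNReal.ofReal (1 - V i z)} := by
    ext z
    rw [Set.mem_ofPred_eq, Set.mem_ofPred_eq, ← ENNReal.ofReal_sum_of_nonneg
      (fun i _ => sub_nonneg.mpr (closeRank_le_one t _ _ i i)), Finset.sum_sub_distrib,
      Finset.sum_const, hK, nsmul_eq_mul, mul_one, ENNReal.ofReal_le_ofReal_iff']
    constructor
    · intro h; left; linarith
    · rintro (h | h) <;> linarith
  rw [← hset] at hmarkov
  have h := ENNReal.toReal_mono ENNReal.ofReal_ne_top (hmarkov.trans hsum)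
  rw [ENNReal.toReal_mul, ENNReal.toReal_ofReal (by positivity),
    ENNReal.toReal_ofReal (by positivity)] at h
  change K / 2 * P.real _ ≤ _ at h
  have h2 : K / 2 * P.real {z | ∑ i with c i = true, V i z ≤ K / 2}
      ≤ K / 2 * (2 * B / t ^ 2) := h.trans (le_of_eq (by ring))
  exact le_of_mul_le_mul_left h2 (by positivity)

lemma measureReal_HCrank_contaminate_lt_le (hn : 4 ≤ n) {t : ℕ} (ht0 : 0 < t) (ht : t ≤ n / 2)
    (htn : 32 * (2 * t + 1) ≤ n) {ρ : ℝ} (h0 : 0 ≤ ρ) (h1 : ρ ≤ 1) (c : Fin n → Bool) {K : ℕ}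
    (hK : (Finset.univ.filter fun i => c i = true).card = K) (hK0 : 0 < K) (hKn : 2 * K ≤ n)
    {L : ℝ} (hL : 0 ≤ L) (hLK : L * √(2 * t + 1) ≤ K / 4) :
    (iid n stdGauss2).real {z | ¬ L ≤ HCrank n (contaminate ρ c z)}
      ≤ 128 * (2 * t + 1) / K ^ 2 + 2 * (n + 4 * n ^ 2 * (1 - ρ)) / t ^ 2 := by
  refine le_trans ?_ (add_le_add
    (measureReal_sum_uncontaminated_le hn ht htn h0 h1 c hK hK0 hKn)
    (measureReal_sum_contaminated_le ht0 h0 h1 c hK hK0))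
  refine (measureReal_mono fun z hz => ?_).trans (measureReal_union_le _ _)
  rw [Set.mem_union, Set.mem_ofPred_eq, Set.mem_ofPred_eq]
  by_contra! hcon
  refine hz ((le_HCrank_iff hn L _).mpr ⟨t, ht, ?_⟩)
  obtain ⟨hμ, hμ', hu⟩ := mul_nullCdf_bounds hn ht
  have hu0 : 0 ≤ nullCdf n t := by
    by_contra! h
    have := mul_nonpos_of_nonneg_of_nonpos (Nat.cast_nonneg (α := ℝ) n) h.le
    linarith
  have hs : L * √(n * nullCdf n t * (1 - nullCdf n t)) ≤ K / 4 := by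
    refine le_trans (mul_le_mul_of_nonneg_left (Real.sqrt_le_sqrt ?_) hL) hLK
    nlinarith
  rw [← Finset.sum_filter_add_sum_filter_not Finset.univ (fun i => c i = true)]
  rw [sum_subtype_eq_false c fun i => closeRank t (fun j => (contaminate ρ c z j).1)
    (fun j => (contaminate ρ c z j).2) i i] at hcon
  linarith [hcon.1, hcon.2]

end TailBounds

section Mixture

variable {n : ℕ}

lemma measureReal_abs_card_sub_ge_le (hn : 0 < n) {ε : ℝ} (h0 : 0 < ε) (h1 : ε ≤ 1) :
    (Measure.pi fun _ : Fin n => labelMeasure ε).real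
        {c | n * ε / 2 ≤ |((Finset.univ.filter fun i => c i = true).card : ℝ) - n * ε|}
      ≤ 4 / (n * ε) := by
  have := isProbabilityMeasure_labelMeasure h0.le h1
  set Q := Measure.pi fun _ : Fin n => labelMeasure ε
  let X : Bool → ℝ := fun b => if b = true then 1 else 0
  have hX : MemLp X 2 (labelMeasure ε) := MemLp.of_bound (by fun_prop) 1
    (ae_of_all _ fun b => by cases b <;> simp [X])
  have hint : ∀ f : Bool → ℝ, ∫ b, f b ∂(labelMeasure ε) = (1 - ε) * f false + ε * f true := by
    intro f
    rw [labelMeasure, integral_add_measure, integral_smul_measure, integral_smul_measure,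
      integral_dirac, integral_dirac, ENNReal.toReal_ofReal (by linarith),
      ENNReal.toReal_ofReal h0.le, smul_eq_mul, smul_eq_mul]
    all_goals exact (integrable_dirac (by simp)).smul_measure ENNReal.ofReal_ne_top
  have hvar : Var[X; labelMeasure ε] ≤ ε := by
    refine (variance_le_expectation_sq hX.aestronglyMeasurable).trans ?_
    rw [hint]
    simp [X]
  have hmem : ∀ i, MemLp (fun c : Fin n → Bool => X (c i)) 2 Q := fun i =>
    hX.comp_measurePreserving (measurePreserving_eval (fun _ : Fin n => labelMeasure ε) i)
  have hmemS : MemLp (∑ i, fun c : Fin n → Bool => X (c i)) 2 Q :=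
    memLp_finsetSum' _ fun i _ => hmem i
  have hvarS := variance_sum_pi (μ := fun _ : Fin n => labelMeasure ε) (fun _ => hX)
  have hmean : Q[∑ i, fun c : Fin n → Bool => X (c i)] = n * ε := by
    simp only [Finset.sum_apply]
    rw [integral_finsetSum _ fun i _ => (hmem i).integrable (by norm_num)]
    have : ∀ i : Fin n, ∫ c, X (c i) ∂Q = ε := fun i => by
      have h := integral_map (μ := Q) (measurable_pi_apply i).aemeasurable
        (f := X) (by fun_prop)
      rw [(measurePreserving_eval (fun _ : Fin n => labelMeasure ε) i).map_eq, hint] at h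
      rw [← h]
      simp [X]
    simp [this]
  have hnε : 0 < n * ε := by positivity
  have hcheb := meas_ge_le_variance_div_sq hmemS (half_pos hnε)
  rw [hmean, hvarS] at hcheb
  have hcard : ∀ c : Fin n → Bool, (∑ i, fun c : Fin n → Bool => X (c i)) c
      = ((Finset.univ.filter fun i => c i = true).card : ℝ) := fun c => by
    simp [X, Finset.sum_apply]
  simp only [hcard] at hcheb
  refine (ENNReal.toReal_le_of_le_ofReal ?_ hcheb).trans ?_
  · exact div_nonneg (Finset.sum_nonneg fun _ _ => variance_nonneg _ _) (sq_nonneg _)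
  · rw [div_le_div_iff₀ (by positivity) hnε, Finset.sum_const, Finset.card_univ, Fintype.card_fin,
      nsmul_eq_mul]
    have := mul_le_mul_of_nonneg_left hvar (Nat.cast_nonneg (α := ℝ) n)
    nlinarith

lemma isProbabilityMeasure_iid_mixture {ε : ℝ} (h0 : 0 ≤ ε) (h1 : ε ≤ 1) (ρ : ℝ) :
    IsProbabilityMeasure (iid n (mixture ε ρ)) := by
  have := isProbabilityMeasure_labelMeasure h0 h1
  rw [iid_mixture_eq_map h0 h1]
  exact Measure.isProbabilityMeasure_map (measurable_contaminate ρ).aemeasurable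

lemma measureReal_HCrank_mixture_lt_le (hn : 4 ≤ n) {t : ℕ} (ht0 : 0 < t)
    (htn : 32 * (2 * t + 1) ≤ n) {ρ : ℝ} (h0 : 0 ≤ ρ) (h1 : ρ ≤ 1) {ε : ℝ} (hε0 : 0 < ε)
    (hε1 : ε ≤ 1 / 3) {L : ℝ} (hL : 0 ≤ L) (hLε : L * √(2 * t + 1) ≤ n * ε / 8) :
    (iid n (mixture ε ρ)).real {z | ¬ L ≤ HCrank n z}
      ≤ 4 / (n * ε) + (512 * (2 * t + 1) / (n * ε) ^ 2
        + 2 * (n + 4 * n ^ 2 * (1 - ρ)) / t ^ 2) := by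
  have hprob := isProbabilityMeasure_labelMeasure hε0.le (by linarith : ε ≤ 1)
  have hnε : 0 < n * ε := by positivity
  have hρ : 0 ≤ 1 - ρ := by linarith
  set δ : ℝ := 512 * (2 * t + 1) / (n * ε) ^ 2 + 2 * (n + 4 * n ^ 2 * (1 - ρ)) / t ^ 2 with hδ
  have hδ0 : 0 ≤ δ := by positivity
  set Q := Measure.pi fun _ : Fin n => labelMeasure ε
  set bad : Set (Fin n → Bool) :=
    {c | n * ε / 2 ≤ |((Finset.univ.filter fun i => c i = true).card : ℝ) - n * ε|}
  have hE : MeasurableSet {z : Fin n → ℝ × ℝ | ¬ L ≤ HCrank n z} :=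
    (measurableSet_le_HCrank hn L).compl
  have hsec : ∀ c, iid n stdGauss2 {z | ¬ L ≤ HCrank n (contaminate ρ c z)}
      ≤ bad.indicator 1 c + ENNReal.ofReal δ := by
    intro c
    by_cases hc : c ∈ bad
    · rw [Set.indicator_of_mem hc]
      exact prob_le_one.trans le_self_add
    · rw [Set.indicator_of_notMem hc, zero_add]
      refine ENNReal.le_ofReal_iff_toReal_le (measure_ne_top _ _) hδ0 |>.mpr ?_
      rw [Set.mem_ofPred_eq, not_le] at hc
      obtain ⟨hc1, hc2⟩ := abs_lt.mp hc
      set K := (Finset.univ.filter fun i => c i = true).card with hK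
      have hK0 : (0 : ℝ) < K := by linarith
      have hKn : 2 * K ≤ n := by
        have : (2 : ℝ) * K ≤ n := by nlinarith
        exact_mod_cast this
      refine (measureReal_HCrank_contaminate_lt_le hn ht0 (by omega) htn h0 h1 c hK.symm
        (by exact_mod_cast hK0) hKn hL (by linarith)).trans (add_le_add ?_ le_rfl)
      rw [div_le_div_iff₀ (by positivity) (by positivity)]
      have hsq : (n * ε) ^ 2 ≤ 4 * (K : ℝ) ^ 2 := by nlinarith
      nlinarith [mul_le_mul_of_nonneg_left hsq (by positivity : (0 : ℝ) ≤ 128 * (2 * t + 1))]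
  have hmeas : iid n (mixture ε ρ) {z | ¬ L ≤ HCrank n z} ≤ Q bad + ENNReal.ofReal δ := by
    rw [iid_mixture_eq_map hε0.le (by linarith), Measure.map_apply (measurable_contaminate ρ) hE,
      Measure.prod_apply (measurable_contaminate ρ hE)]
    refine (lintegral_mono hsec).trans ?_
    have hb : MeasurableSet bad := Set.Finite.measurableSet (Set.toFinite _)
    rw [lintegral_add_right _ measurable_const, lintegral_indicator_one hb, lintegral_const,
      measure_univ, mul_one]
  have h := ENNReal.toReal_mono (by finiteness) hmeas
  rw [ENNReal.toReal_add (by finiteness) (by finiteness), ENNReal.toReal_ofReal hδ0] at h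
  exact h.trans (add_le_add (measureReal_abs_card_sub_ge_le (by omega) hε0 (by linarith)) le_rfl)

end Mixture

section Observations

variable {n : ℕ} {F G : ℝ → ℝ}

lemma map_obsMap_HCrank (hn : 4 ≤ n) (hF_mono : StrictMono F) (hF_cont : Continuous F)
    (hF_bot : Tendsto F atBot (𝓝 0)) (hF_top : Tendsto F atTop (𝓝 1))
    (hG_mono : StrictMono G) (hG_cont : Continuous G)
    (hG_bot : Tendsto G atBot (𝓝 0)) (hG_top : Tendsto G atTop (𝓝 1))
    (P : Measure (Fin n → ℝ × ℝ)) (L : ℝ) :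
    (P.map (obsMap F G n)) {x | L ≤ HCrank n x} = P {z | L ≤ HCrank n z} := by
  have hf := strictMono_invFun_Phi hF_mono hF_cont hF_bot hF_top
  have hg := strictMono_invFun_Phi hG_mono hG_cont hG_bot hG_top
  have hf' := hf.monotone.measurable
  have hg' := hg.monotone.measurable
  have hm : Measurable (obsMap F G n) := measurable_pi_lambda _ fun i =>
    (hf'.comp (measurable_fst.comp (measurable_pi_apply i))).prodMk
      (hg'.comp (measurable_snd.comp (measurable_pi_apply i)))
  rw [Measure.map_apply hm (measurableSet_le_HCrank hn L)]
  congr 1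
  ext z
  exact iff_of_eq (congrArg (L ≤ ·) (HCrank_map_of_strictMono hf hg z))

end Observations

section Asymptotics

lemma tendsto_natCast_rpow_of_neg {a : ℝ} (ha : a < 0) :
    Tendsto (fun n : ℕ => (n : ℝ) ^ a) atTop (𝓝 0) := by
  simpa [Function.comp_def] using
    (tendsto_rpow_neg_atTop (neg_pos.mpr ha)).comp tendsto_natCast_atTop_atTop

lemma tendsto_log_sq_mul_rpow_of_neg {a : ℝ} (ha : a < 0) :
    Tendsto (fun n : ℕ => Real.log n ^ 2 * (n : ℝ) ^ a) atTop (𝓝 0) := by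
  have h := (isLittleO_log_rpow_rpow_atTop 2 (neg_pos.mpr ha)).tendsto_div_nhds_zero.comp
    tendsto_natCast_atTop_atTop
  refine h.congr fun n => ?_
  simp [Real.rpow_neg (Nat.cast_nonneg n)]

lemma tendsto_mul_exp_neg_log_sq :
    Tendsto (fun n : ℕ => n * rexp (1 / 12 - Real.log n ^ 2 / 24)) atTop (𝓝 0) := by
  have hlog : Tendsto (fun n : ℕ => Real.log n) atTop atTop :=
    Real.tendsto_log_atTop.comp tendsto_natCast_atTop_atTop
  have h : Tendsto (fun y : ℝ => rexp (1 / 12 + y * (1 - y / 24))) atTop (𝓝 0) := by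
    refine Real.tendsto_exp_atBot.comp (tendsto_atBot_add_const_left _ _ ?_)
    refine tendsto_id.atTop_mul_atBot₀ ?_
    refine tendsto_atBot_add_const_left _ _ (tendsto_neg_atTop_atBot.comp ?_)
    exact tendsto_id.atTop_div_const (by norm_num)
  refine (h.comp hlog).congr' ?_
  filter_upwards [eventually_gt_atTop 0] with n hn
  have hn' : (0 : ℝ) < n := by exact_mod_cast hn
  have e : 1 / 12 + Real.log n * (1 - Real.log n / 24)
      = Real.log n + (1 / 12 - Real.log n ^ 2 / 24) := by ring
  rw [Function.comp_apply, e, Real.exp_add, Real.exp_log hn']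

lemma tendsto_measureReal_HCrank_mixture_lt {β γ : ℝ} (hβ0 : 1 / 2 < β) (hβ1 : β < 3 / 4)
    (hsparse : 4 * (β - 1 / 2) < γ) :
    Tendsto (fun n : ℕ => (iid n (mixture ((n : ℝ) ^ (-β)) (1 - (n : ℝ) ^ (-γ)))).real
      {z | ¬ Real.log n ^ 2 ≤ HCrank n z}) atTop (𝓝 0) := by
  obtain ⟨κ, hκ1, hκ2⟩ : ∃ κ, max (1 / 2) (1 - γ / 2) < κ ∧ κ < 2 * (1 - β) :=
    exists_between (max_lt (by linarith) (by linarith))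
  obtain ⟨hκ3, hκ4⟩ := max_lt_iff.mp hκ1
  have hbound : Tendsto (fun n : ℕ => 4 * (n : ℝ) ^ (β - 1)
      + (1536 * (n : ℝ) ^ (κ - 2 * (1 - β)) + (8 * (n : ℝ) ^ (1 - 2 * κ)
        + 32 * (n : ℝ) ^ (2 - γ - 2 * κ)))) atTop (𝓝 0) := by
    have h1 := (tendsto_natCast_rpow_of_neg (by linarith : β - 1 < 0)).const_mul 4
    have h2 := (tendsto_natCast_rpow_of_neg (by linarith : κ - 2 * (1 - β) < 0)).const_mul 1536
    have h3 := (tendsto_natCast_rpow_of_neg (by linarith : 1 - 2 * κ < 0)).const_mul 8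
    have h4 := (tendsto_natCast_rpow_of_neg (by linarith : 2 - γ - 2 * κ < 0)).const_mul 32
    simpa using h1.add (h2.add (h3.add h4))
  have e1 := (tendsto_natCast_rpow_of_neg (by linarith : κ - 1 < 0)).eventually
    (ge_mem_nhds (by norm_num : (0 : ℝ) < 1 / 96))
  have e2 := (tendsto_natCast_rpow_of_neg (by linarith : -β < 0)).eventually
    (ge_mem_nhds (by norm_num : (0 : ℝ) < 1 / 3))
  have e3 := (tendsto_log_sq_mul_rpow_of_neg (by linarith : κ / 2 - (1 - β) < 0)).eventually
    (ge_mem_nhds (by norm_num : (0 : ℝ) < 1 / 16))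
  refine squeeze_zero' (Eventually.of_forall fun n => measureReal_nonneg) ?_ hbound
  filter_upwards [e1, e2, e3, eventually_ge_atTop 4] with n e1 e2 e3 hn
  have hn1 : (1 : ℝ) ≤ n := by exact_mod_cast (by omega : 1 ≤ n)
  have hn0 : (0 : ℝ) < n := by linarith
  set x : ℝ := (n : ℝ) ^ κ with hx
  have hx1 : 1 ≤ x := Real.one_le_rpow hn1 (by linarith)
  set t := ⌊x⌋₊
  have ht1 : 1 ≤ t := Nat.le_floor (by simpa using hx1)
  have ht1' : (1 : ℝ) ≤ t := by exact_mod_cast ht1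
  have htx : (t : ℝ) ≤ x := Nat.floor_le (by linarith)
  have hxt : x / 2 ≤ t := by linarith [Nat.lt_floor_add_one x]
  have hn_mul : ∀ a : ℝ, (n : ℝ) * n ^ a = n ^ (1 + a) := fun a => by
    rw [Real.rpow_add hn0, Real.rpow_one]
  have hxn : 96 * x ≤ n := by
    rw [Real.rpow_sub_one hn0.ne', div_le_div_iff₀ hn0 (by norm_num)] at e1
    linarith
  have hγn : (n : ℝ) ^ (-γ) ≤ 1 := Real.rpow_le_one_of_one_le_of_nonpos hn1 (by linarith)
  have hγn0 : 0 ≤ (n : ℝ) ^ (-γ) := Real.rpow_nonneg hn0.le _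
  have hsqrt : √(2 * t + 1) ≤ 2 * (n : ℝ) ^ (κ / 2) := by
    refine Real.sqrt_le_iff.mpr ⟨by positivity, ?_⟩
    rw [mul_pow, ← Real.rpow_natCast ((n : ℝ) ^ (κ / 2)), ← Real.rpow_mul hn0.le]
    norm_num
    linarith
  refine (measureReal_HCrank_mixture_lt_le hn ht1 ?_ (by linarith) (by linarith)
    (Real.rpow_pos_of_pos hn0 _) e2 (sq_nonneg _) ?_).trans ?_
  · have : (32 : ℝ) * (2 * t + 1) ≤ n := by linarith
    exact_mod_cast this
  · rw [Real.rpow_sub hn0, ← mul_div_assoc, div_le_div_iff₀ (Real.rpow_pos_of_pos hn0 _)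
      (by norm_num)] at e3
    rw [hn_mul, ← sub_eq_add_neg]
    nlinarith [mul_le_mul_of_nonneg_left hsqrt (sq_nonneg (Real.log n))]
  · rw [hn_mul, ← sub_eq_add_neg]
    refine add_le_add (le_of_eq ?_) (add_le_add ?_ ?_)
    · rw [show β - 1 = -(1 - β) by ring, Real.rpow_neg hn0.le, div_eq_mul_inv]
    · rw [Real.rpow_sub hn0 κ, ← mul_div_assoc, ← Real.rpow_natCast ((n : ℝ) ^ (1 - β)),
        ← Real.rpow_mul hn0.le, Nat.cast_ofNat, mul_comm (1 - β) 2]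
      refine div_le_div_of_nonneg_right ?_ (Real.rpow_nonneg hn0.le _)
      linarith
    · have hx2 : (n : ℝ) ^ (2 * κ) = x ^ 2 := by
        rw [hx, ← Real.rpow_natCast, ← Real.rpow_mul hn0.le, Nat.cast_ofNat, mul_comm]
      have hx0 : 0 < x ^ 2 := by positivity
      have hr : (8 * (n : ℝ) ^ (1 - 2 * κ) + 32 * (n : ℝ) ^ (2 - γ - 2 * κ))
          = 8 * (n + 4 * n ^ 2 * n ^ (-γ)) / x ^ 2 := by
        rw [Real.rpow_sub hn0, Real.rpow_sub hn0, hx2, Real.rpow_one, sub_eq_add_neg,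
          Real.rpow_add hn0, Real.rpow_two]
        ring
      rw [hr, sub_sub_cancel, div_le_div_iff₀ (by positivity) hx0]
      have : x ^ 2 ≤ 4 * (t : ℝ) ^ 2 := by nlinarith
      nlinarith [mul_le_mul_of_nonneg_left this
        (by positivity : 0 ≤ 2 * ((n : ℝ) + 4 * n ^ 2 * n ^ (-γ)))]

end Asymptotics

/-- in the moderately sparse regime (`1/2 < β < 3/4`, `γ > 4(β - 1/2)`),
in the Gaussian mixture copula model with strictly increasing continuous marginal
distribution functions `F, G`, the higher criticism rank test rejecting when
`HC_rank ≥ (log n)²` is asymptotically powerful: its type I error probability (computed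
under the null, where the latent correlation is absent, so the `Xᵢ`'s and `Yᵢ`'s are all
mutually independent with continuous marginals) and its type II error probability both
tend to 0. -/
theorem HCrank_moderately_sparse_powerful (β γ : ℝ) (hβ0 : 1 / 2 < β) (hβ1 : β < 3 / 4)
    (hγ0 : 0 < γ) (hsparse : 4 * (β - 1 / 2) < γ)
    (ε ρ : ℕ → ℝ) (hε : ∀ n : ℕ, ε n = (n : ℝ) ^ (-β))
    (hρ : ∀ n : ℕ, ρ n = 1 - (n : ℝ) ^ (-γ))
    (F G : ℝ → ℝ)
    (hF_mono : StrictMono F) (hF_cont : Continuous F)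
    (hF_bot : Tendsto F atBot (𝓝 0)) (hF_top : Tendsto F atTop (𝓝 1))
    (hG_mono : StrictMono G) (hG_cont : Continuous G)
    (hG_bot : Tendsto G atBot (𝓝 0)) (hG_top : Tendsto G atTop (𝓝 1)) :
    Tendsto (fun n =>
      (((iid n (biNormal 0)).map (obsMap F G n))
          {x : Fin n → ℝ × ℝ | (Real.log n) ^ 2 ≤ HCrank n x}).toReal
        + (1 - (((iid n (mixture (ε n) (ρ n))).map (obsMap F G n))
          {x : Fin n → ℝ × ℝ | (Real.log n) ^ 2 ≤ HCrank n x}).toReal))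
      atTop (𝓝 0) := by
  have hI : Tendsto (fun n : ℕ => (iid n stdGauss2).real {z | Real.log n ^ 2 ≤ HCrank n z})
      atTop (𝓝 0) := by
    refine squeeze_zero' (Eventually.of_forall fun n => measureReal_nonneg) ?_
      tendsto_mul_exp_neg_log_sq
    filter_upwards [eventually_ge_atTop 4] with n hn
    exact measureReal_le_HCrank_le hn (sq_nonneg _)
  have hII := tendsto_measureReal_HCrank_mixture_lt hβ0 hβ1 hsparse
  have h := hI.add hII
  rw [add_zero] at h
  refine h.congr' ?_
  filter_upwards [eventually_ge_atTop 4] with n hn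
  have hn1 : (1 : ℝ) ≤ n := by exact_mod_cast (by omega : 1 ≤ n)
  rw [map_obsMap_HCrank hn hF_mono hF_cont hF_bot hF_top hG_mono hG_cont hG_bot hG_top,
    map_obsMap_HCrank hn hF_mono hF_cont hF_bot hF_top hG_mono hG_cont hG_bot hG_top,
    biNormal_zero, hε, hρ]
  have := isProbabilityMeasure_iid_mixture (n := n) (ε := (n : ℝ) ^ (-β)) (by positivity)
    (Real.rpow_le_one_of_one_le_of_nonpos hn1 (by linarith)) (1 - (n : ℝ) ^ (-γ))
  congr 1
  exact probReal_compl_eq_one_sub (measurableSet_le_HCrank hn (Real.log n ^ 2))
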